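/- Let (X,ρ,μ) be a quasi-metric measure space in which μ is Borel regular and Q-doubling for some Q ∈ (0,∞). Fix s,p ∈ (0,∞) and q ∈ (0,∞] with s ⪯_q ind(X,ρ). If Ω ⊂ X is a nonempty μ-measurable set satisfying the measure density condition, then there exists a constant C > 0 such that for every u ∈ M^s_{p,q}(Ω,ρ,μ) there exists ũ ∈ M^s_{p,q}(X,ρ,μ) with ũ|_Ω = u μ-almost everywhere on Ω and ‖ũ‖_{M^s_{p,q}(X,ρ,μ)} ≤ C ‖u‖_{M^s_{p,q}(Ω,ρ,μ)}. -/

import Mathlib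

open MeasureTheory ENNReal Set

noncomputable section

namespace HajlaszPaper

variable {X : Type*}

/-- The `ρ`-ball centered at `x` with radius `r`. -/
def qball (ρ : X → X → ℝ) (x : X) (r : ℝ) : Set X := {y | ρ x y < r}

/-- `ρ` is a quasi-metric on `X`. -/
def IsQuasiDist (ρ : X → X → ℝ) : Prop :=
  (∀ x y, 0 ≤ ρ x y) ∧ (∀ x y, ρ x y = 0 ↔ x = y) ∧
    (∃ C₀ : ℝ, 1 ≤ C₀ ∧ ∀ x y, ρ y x ≤ C₀ * ρ x y) ∧
    (∃ C₁ : ℝ, 1 ≤ C₁ ∧ ∀ x y z, ρ x y ≤ C₁ * max (ρ x z) (ρ z y))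

/-- The least admissible quasi-triangle constant `C_ρ`. -/
def Crho (ρ : X → X → ℝ) : ℝ :=
  sInf {C : ℝ | 1 ≤ C ∧ ∀ x y z : X, ρ x y ≤ C * max (ρ x z) (ρ z y)}

/-- The least admissible quasi-symmetry constant `C̃_ρ`. -/
def CrhoTilde (ρ : X → X → ℝ) : ℝ :=
  sInf {C : ℝ | 1 ≤ C ∧ ∀ x y : X, ρ y x ≤ C * ρ x y}

/-- Two quasi-metrics are (bi-Lipschitz, i.e. pointwise) equivalent. -/
def EquivQM (ρ ϱ : X → X → ℝ) : Prop :=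
  ∃ c : ℝ, 1 ≤ c ∧ ∀ x y, c⁻¹ * ϱ x y ≤ ρ x y ∧ ρ x y ≤ c * ϱ x y

variable [MeasurableSpace X]

/-- `(X, ρ, μ)` is a quasi-metric measure space. -/
structure IsQMMS (ρ : X → X → ℝ) (μ : Measure X) : Prop where
  nontrivial : ∃ x y : X, x ≠ y
  quasi : IsQuasiDist ρ
  measurableSet_ball : ∀ (x : X) (r : ℝ), 0 < r → MeasurableSet (qball ρ x r)
  ball_pos : ∀ (x : X) (r : ℝ), 0 < r → 0 < μ (qball ρ x r)
  ball_lt_top : ∀ (x : X) (r : ℝ), 0 < r → μ (qball ρ x r) < ∞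

/-- Every `μ`-measurable set is contained in a Borel (measurable) set of equal measure. -/
def BorelRegular (μ : Measure X) : Prop :=
  ∀ A : Set X, ∃ B : Set X, A ⊆ B ∧ MeasurableSet B ∧ μ A = μ B

/-- `μ` is `Q`-doubling. -/
def QDoubling (ρ : X → X → ℝ) (μ : Measure X) (Q : ℝ) : Prop :=
  ∃ κ : ℝ, 0 < κ ∧ ∀ (x y : X) (r R : ℝ), 0 < r → r ≤ R →
    qball ρ x r ⊆ qball ρ y R →
    ENNReal.ofReal (κ * (r / R) ^ Q) * μ (qball ρ y R) ≤ μ (qball ρ x r)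

/-- `μ` is doubling. -/
def DoublingMeas (ρ : X → X → ℝ) (μ : Measure X) : Prop :=
  ∃ Cd : ℝ, 0 < Cd ∧ ∀ (x : X) (r : ℝ), 0 < r →
    μ (qball ρ x (2 * r)) ≤ ENNReal.ofReal Cd * μ (qball ρ x r)

/-- The measure density condition for `Ω`. -/
def MeasDensity (ρ : X → X → ℝ) (μ : Measure X) (Ω : Set X) : Prop :=
  ∃ c : ℝ, 0 < c ∧ ∀ x ∈ Ω, ∀ r : ℝ, 0 < r → r ≤ 1 →
    μ (qball ρ x r) ≤ ENNReal.ofReal c * μ (qball ρ x r ∩ Ω)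

/-- `Ω` is locally uniformly perfect with constant `lam ∈ (0,1)`. -/
def LocUnifPerfect (ρ : X → X → ℝ) (Ω : Set X) (lam : ℝ) : Prop :=
  ∀ x ∈ Ω, ∀ r : ℝ, 0 < r → r ≤ 1 → (Ω \ qball ρ x r).Nonempty →
    ((qball ρ x r ∩ Ω) \ qball ρ x (lam * r)).Nonempty

/-- The critical radius `φ^x_{Ω,ρ}(r)`. -/
def phiRad (ρ : X → X → ℝ) (μ : Measure X) (Ω : Set X) (x : X) (r : ℝ) : ℝ :=
  sSup {t : ℝ | 0 ≤ t ∧ t ≤ r ∧ μ (qball ρ x t ∩ Ω) ≤ μ (qball ρ x r ∩ Ω) / 2}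

/-- The collection `𝔻^s_ρ(u)` of fractional `s`-gradients of `u` on `Ω`. -/
def fracGrad (ρ : X → X → ℝ) (μ : Measure X) (Ω : Set X) (s : ℝ) (u : X → ℝ) :
    Set (ℤ → X → ℝ) :=
  {g | (∀ k x, 0 ≤ g k x) ∧ (∀ k, AEMeasurable (g k) (μ.restrict Ω)) ∧
    ∃ E : Set X, μ E = 0 ∧ ∀ k : ℤ, ∀ x ∈ Ω \ E, ∀ y ∈ Ω \ E,
      (2 : ℝ) ^ (-k - 1) ≤ ρ x y → ρ x y < (2 : ℝ) ^ (-k) →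
      |u x - u y| ≤ ρ x y ^ s * (g k x + g k y)}

/-- `g` is an `s`-gradient of `u` on `S`. -/
def IsSGradOn (ρ : X → X → ℝ) (μ : Measure X) (S : Set X) (s : ℝ) (u g : X → ℝ) : Prop :=
  (∀ x, 0 ≤ g x) ∧ AEMeasurable g (μ.restrict S) ∧
    ∃ E : Set X, μ E = 0 ∧ ∀ x ∈ S \ E, ∀ y ∈ S \ E,
      |u x - u y| ≤ ρ x y ^ s * (g x + g y)

/-- The `ℓ^q` norm (`0 < q ≤ ∞`) of a `ℤ`-indexed sequence in `[0,∞]`. -/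
def lqN (q : ℝ≥0∞) (a : ℤ → ℝ≥0∞) : ℝ≥0∞ :=
  if q = ∞ then ⨆ k, a k else (∑' k, a k ^ q.toReal) ^ (1 / q.toReal)

/-- The `L^p` "norm" (`0 < p < ∞`) of a `[0,∞]`-valued function. -/
def lpN (μ : Measure X) (p : ℝ) (f : X → ℝ≥0∞) : ℝ≥0∞ :=
  (∫⁻ x, f x ^ p ∂μ) ^ (1 / p)

/-- The `L^p` norm of `u : X → ℝ` over the set `Ω`. -/
def lpOn (μ : Measure X) (Ω : Set X) (p : ℝ) (u : X → ℝ) : ℝ≥0∞ :=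
  lpN (μ.restrict Ω) p fun x => ENNReal.ofReal |u x|

/-- The homogeneous Hajłasz–Triebel–Lizorkin quasi-norm `‖u‖_{Ṁ^s_{p,q}(Ω,ρ,μ)}`. -/
def MdotNorm (ρ : X → X → ℝ) (μ : Measure X) (Ω : Set X) (s p : ℝ) (q : ℝ≥0∞)
    (u : X → ℝ) : ℝ≥0∞ :=
  ⨅ g ∈ fracGrad ρ μ Ω s u,
    lpN (μ.restrict Ω) p fun x => lqN q fun k => ENNReal.ofReal (g k x)

/-- The homogeneous Hajłasz–Besov quasi-norm `‖u‖_{Ṅ^s_{p,q}(Ω,ρ,μ)}`. -/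
def NdotNorm (ρ : X → X → ℝ) (μ : Measure X) (Ω : Set X) (s p : ℝ) (q : ℝ≥0∞)
    (u : X → ℝ) : ℝ≥0∞ :=
  ⨅ g ∈ fracGrad ρ μ Ω s u,
    lqN q fun k => lpN (μ.restrict Ω) p fun x => ENNReal.ofReal (g k x)

/-- Membership in `M^s_{p,q}(Ω,ρ,μ)`. -/
def MemMspq (ρ : X → X → ℝ) (μ : Measure X) (Ω : Set X) (s p : ℝ) (q : ℝ≥0∞)
    (u : X → ℝ) : Prop :=
  AEMeasurable u (μ.restrict Ω) ∧ lpOn μ Ω p u ≠ ∞ ∧ MdotNorm ρ μ Ω s p q u ≠ ∞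

/-- Membership in `N^s_{p,q}(Ω,ρ,μ)`. -/
def MemNspq (ρ : X → X → ℝ) (μ : Measure X) (Ω : Set X) (s p : ℝ) (q : ℝ≥0∞)
    (u : X → ℝ) : Prop :=
  AEMeasurable u (μ.restrict Ω) ∧ lpOn μ Ω p u ≠ ∞ ∧ NdotNorm ρ μ Ω s p q u ≠ ∞

/-- The quasi-norm of `M^s_{p,q}(Ω,ρ,μ)`. -/
def MNorm (ρ : X → X → ℝ) (μ : Measure X) (Ω : Set X) (s p : ℝ) (q : ℝ≥0∞)
    (u : X → ℝ) : ℝ≥0∞ :=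
  MdotNorm ρ μ Ω s p q u + lpOn μ Ω p u

/-- The quasi-norm of `N^s_{p,q}(Ω,ρ,μ)`. -/
def NNorm (ρ : X → X → ℝ) (μ : Measure X) (Ω : Set X) (s p : ℝ) (q : ℝ≥0∞)
    (u : X → ℝ) : ℝ≥0∞ :=
  NdotNorm ρ μ Ω s p q u + lpOn μ Ω p u

/-- `s ⪯_q ind(X,ρ)` : there is a quasi-metric `ϱ ≈ ρ` with `s ≤ (log₂ C_ϱ)⁻¹`
(equivalently `C_ϱ ^ s ≤ 2`), where equality is permitted only when `q = ∞`. -/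
def SPrecIndex (ρ : X → X → ℝ) (s : ℝ) (q : ℝ≥0∞) : Prop :=
  ∃ ϱ : X → X → ℝ, IsQuasiDist ϱ ∧ EquivQM ρ ϱ ∧
    (Crho ϱ ^ s < 2 ∨ (q = ∞ ∧ Crho ϱ ^ s ≤ 2))

/-- `s < ind(X,ρ)` : there is a quasi-metric `ϱ ≈ ρ` with `s < (log₂ C_ϱ)⁻¹`
(equivalently `C_ϱ ^ s < 2`). -/
def SLtIndex (ρ : X → X → ℝ) (s : ℝ) : Prop :=
  ∃ ϱ : X → X → ℝ, IsQuasiDist ϱ ∧ EquivQM ρ ϱ ∧ Crho ϱ ^ s < 2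

/-- The median value `m_u(E)`. -/
def medianVal (μ : Measure X) (E : Set X) (u : X → ℝ) : ℝ :=
  sSup {θ : ℝ | μ {x ∈ E | u x < θ} ≤ μ E / 2}

/-- `f` belongs to the homogeneous Hölder space `Ċ^α(X,ρ)`. -/
def MemHolder (ρ : X → X → ℝ) (α : ℝ) (f : X → ℝ) : Prop :=
  ∃ H : ℝ, 0 ≤ H ∧ ∀ x y : X, |f x - f y| ≤ H * ρ x y ^ α

/-- The Hölder seminorm `‖f‖_{Ċ^α(X,ρ)}`. -/
def holderNorm (ρ : X → X → ℝ) (α : ℝ) (f : X → ℝ) : ℝ :=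
  sInf {H : ℝ | 0 ≤ H ∧ ∀ x y : X, |f x - f y| ≤ H * ρ x y ^ α}

/-- The sup norm of `f`. -/
def supNorm (f : X → ℝ) : ℝ := sSup (Set.range fun x => |f x|)

/-- `ρ` is a genuine metric. -/
def IsMetricDist (ρ : X → X → ℝ) : Prop :=
  (∀ x y, 0 ≤ ρ x y) ∧ (∀ x y, ρ x y = 0 ↔ x = y) ∧ (∀ x y, ρ x y = ρ y x) ∧
    (∀ x y z, ρ x y ≤ ρ x z + ρ z y)

/-- The homogeneous Hajłasz–Sobolev quasi-norm `‖u‖_{Ṁ^{1,p}(Ω,ρ,μ)}`. -/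
def M1pDotNorm (ρ : X → X → ℝ) (μ : Measure X) (Ω : Set X) (p : ℝ) (u : X → ℝ) : ℝ≥0∞ :=
  ⨅ g ∈ {g : X → ℝ | IsSGradOn ρ μ Ω 1 u g},
    lpN (μ.restrict Ω) p fun x => ENNReal.ofReal (g x)

/-- Membership in the Hajłasz–Sobolev space `M^{1,p}(Ω,ρ,μ)`. -/
def MemM1p (ρ : X → X → ℝ) (μ : Measure X) (Ω : Set X) (p : ℝ) (u : X → ℝ) : Prop :=
  AEMeasurable u (μ.restrict Ω) ∧ lpOn μ Ω p u ≠ ∞ ∧ M1pDotNorm ρ μ Ω p u ≠ ∞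

/-- The quasi-norm of `M^{1,p}(Ω,ρ,μ)`. -/
def M1pNorm (ρ : X → X → ℝ) (μ : Measure X) (Ω : Set X) (p : ℝ) (u : X → ℝ) : ℝ≥0∞ :=
  lpOn μ Ω p u + M1pDotNorm ρ μ Ω p u

section Frink

/-- Frink's chain inequality in interval form. -/
theorem frink_chain_interval {Y : Type*} (e : Y → Y → ℝ) (h0 : ∀ x y, 0 ≤ e x y)
    (h2 : ∀ x y z, e x z ≤ 2 * max (e x y) (e y z)) (f : ℕ → Y) :
    ∀ l m : ℕ, e (f m) (f (m + l + 2)) ≤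
      4 * (∑ i ∈ Finset.range (m + l + 2), e (f i) (f (i + 1))
        - ∑ i ∈ Finset.range m, e (f i) (f (i + 1)))
        - 2 * e (f m) (f (m + 1)) - 2 * e (f (m + l + 1)) (f (m + l + 2)) := by
  set P : ℕ → ℝ := fun n => ∑ i ∈ Finset.range n, e (f i) (f (i + 1)) with hP
  have hPs : ∀ n, P (n + 1) = P n + e (f n) (f (n + 1)) := fun n => Finset.sum_range_succ _ n
  have hPm : Monotone P := monotone_nat_of_le_succ fun n => by
    rw [hPs]; linarith [h0 (f n) (f (n + 1))]
  intro l
  induction l using Nat.strong_induction_on with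
  | _ l ih =>
    intro m
    change e (f m) (f (m + l + 2)) ≤ 4 * (P (m + l + 2) - P m) - 2 * e (f m) (f (m + 1))
      - 2 * e (f (m + l + 1)) (f (m + l + 2))
    have e1 := hPs m
    have e2 := hPs (m + l + 1)
    have e3 : P (m + 1) ≤ P (m + l + 1) := hPm (by omega)
    have e4 := h0 (f m) (f (m + 1))
    have e5 := h0 (f (m + l + 1)) (f (m + l + 2))
    classical
    let good : ℕ → Prop := fun j => e (f m) (f (m + l + 2)) ≤ 2 * e (f (m + j)) (f (m + l + 2))
    have hg0 : good 0 := by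
      change _ ≤ _
      have := h0 (f m) (f (m + l + 2))
      simp only [add_zero]
      linarith
    set p := Nat.findGreatest good (l + 1) with hp
    have hgp : good p := Nat.findGreatest_spec (P := good) (Nat.zero_le _) hg0
    have hple : p ≤ l + 1 := Nat.findGreatest_le _
    by_cases hpl : p = l + 1
    · have : e (f m) (f (m + l + 2)) ≤ 2 * e (f (m + (l + 1))) (f (m + l + 2)) := hpl ▸ hgp
      rw [← add_assoc] at this
      linarith
    · have hng : ¬ good (p + 1) :=
        Nat.findGreatest_is_greatest (P := good) (k := p + 1) (n := l + 1) (by omega) (by omega)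
      have hlt : 2 * e (f (m + (p + 1))) (f (m + l + 2)) < e (f m) (f (m + l + 2)) :=
        not_le.mp hng
      have hle : e (f m) (f (m + l + 2)) ≤ 2 * e (f m) (f (m + (p + 1))) := by
        have := h2 (f m) (f (m + (p + 1))) (f (m + l + 2))
        rcases max_choice (e (f m) (f (m + (p + 1)))) (e (f (m + (p + 1))) (f (m + l + 2)))
          with h | h <;> rw [h] at this <;> linarith
      by_cases hp0 : p = 0
      · rw [hp0] at hle
        simp only [zero_add] at hle
        linarith
      · have i1 := ih (p - 1) (by omega) m
        have i2 := ih (l - p) (by omega) (m + p)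
        have n1 : m + (p - 1) + 2 = m + (p + 1) := by omega
        have n2 : m + (p - 1) + 1 = m + p := by omega
        have n3 : m + p + (l - p) + 2 = m + l + 2 := by omega
        have n4 : m + p + (l - p) + 1 = m + l + 1 := by omega
        rw [n1, n2] at i1
        rw [n3, n4] at i2
        have e6 := hPs (m + p)
        have n5 : m + p + 1 = m + (p + 1) := by omega
        rw [n5] at e6 i2
        change e (f m) (f (m + (p + 1))) ≤ 4 * (P (m + (p + 1)) - P m) - _ - _ at i1
        change e (f (m + p)) (f (m + l + 2)) ≤ 4 * (P (m + l + 2) - P (m + p)) - _ - _ at i2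
        have hgp' : e (f m) (f (m + l + 2)) ≤ 2 * e (f (m + p)) (f (m + l + 2)) := hgp
        linarith

theorem frink_chain {Y : Type*} (e : Y → Y → ℝ) (h0 : ∀ x y, 0 ≤ e x y)
    (hself : ∀ x, e x x = 0)
    (h2 : ∀ x y z, e x z ≤ 2 * max (e x y) (e y z)) (f : ℕ → Y) (n : ℕ) :
    e (f 0) (f n) ≤ 4 * ∑ i ∈ Finset.range n, e (f i) (f (i + 1)) := by
  match n with
  | 0 => simp [hself]
  | 1 => simp; linarith [h0 (f 0) (f 1)]
  | l + 2 =>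
    have := frink_chain_interval e h0 h2 f l 0
    have a1 := h0 (f 0) (f (0 + 1))
    have a2 := h0 (f (0 + l + 1)) (f (0 + l + 2))
    simp only [zero_add, Finset.range_zero, Finset.sum_empty, sub_zero] at this a1 a2
    linarith

theorem list_chain_eq_sum {Y : Type*} (e : Y → Y → NNReal) (y : Y) :
    ∀ (l : List Y) (x : Y), ∃ f : ℕ → Y, f 0 = x ∧ f (l.length + 1) = y ∧
      (List.zipWith e (x :: l) (l ++ [y])).sum =
        ∑ i ∈ Finset.range (l.length + 1), e (f i) (f (i + 1)) := by
  intro l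
  induction l with
  | nil =>
    intro x
    exact ⟨fun n => if n = 0 then x else y, by simp, by simp, by simp⟩
  | cons a l ih =>
    intro x
    obtain ⟨f, hf0, hf1, hf⟩ := ih a
    refine ⟨fun n => Nat.casesOn n x f, rfl, by simpa using hf1, ?_⟩
    rw [List.length_cons, Finset.sum_range_succ']
    simp only [List.cons_append, List.zipWith_cons_cons, List.sum_cons]
    rw [hf, hf0, add_comm]
    rfl

/-- Frink metrization: a symmetric quasi-metric with constant `2` is comparable to a metric. -/
theorem frink_metric {Y : Type*} (e : Y → Y → NNReal) (hself : ∀ x, e x x = 0)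
    (hcomm : ∀ x y, e x y = e y x) (hne : ∀ x y, e x y = 0 → x = y)
    (h2 : ∀ x y z, e x z ≤ 2 * max (e x y) (e y z)) :
    ∃ _ : MetricSpace Y, ∀ x y : Y, dist x y ≤ e x y ∧ (e x y : ℝ) ≤ 4 * dist x y := by
  let I : PseudoMetricSpace Y := PseudoMetricSpace.ofPreNNDist e hself hcomm
  have key : ∀ x y : Y, dist x y ≤ e x y ∧ (e x y : ℝ) ≤ 4 * dist x y := by
    intro x y
    refine ⟨PseudoMetricSpace.dist_ofPreNNDist_le e hself hcomm x y, ?_⟩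
    rw [PseudoMetricSpace.dist_ofPreNNDist e hself hcomm]
    have : e x y / 4 ≤ ⨅ l, (List.zipWith e (x :: l) (l ++ [y])).sum := by
      refine le_ciInf fun l => ?_
      obtain ⟨f, hf0, hf1, hf⟩ := list_chain_eq_sum e y l x
      have := frink_chain (fun a b => (e a b : ℝ)) (fun _ _ => NNReal.coe_nonneg _)
        (fun a => by simp [hself]) (fun a b c => by exact_mod_cast h2 a b c) f (l.length + 1)
      rw [hf0, hf1] at this
      rw [hf]
      rw [div_le_iff₀ (by norm_num), mul_comm]
      exact_mod_cast this
    have h' : ((e x y / 4 : NNReal) : ℝ) ≤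
        ((⨅ l, (List.zipWith e (x :: l) (l ++ [y])).sum : NNReal) : ℝ) := by exact_mod_cast this
    push_cast at h'
    push_cast
    linarith
  refine ⟨{ I with eq_of_dist_eq_zero := fun {x y} h => ?_ }, key⟩
  have := (key x y).2
  rw [h] at this
  refine hne x y ?_
  have h3 : (e x y : ℝ) = 0 := le_antisymm (by linarith) (NNReal.coe_nonneg _)
  exact_mod_cast h3

theorem Crho_spec {Y : Type*} {e : Y → Y → ℝ} (he : IsQuasiDist e) :
    1 ≤ Crho e ∧ ∀ x y z, e x y ≤ Crho e * max (e x z) (e z y) := by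
  obtain ⟨h0, -, -, C, hC1, hC⟩ := he
  have hbdd : BddBelow {C : ℝ | 1 ≤ C ∧ ∀ x y z : Y, e x y ≤ C * max (e x z) (e z y)} :=
    ⟨1, fun c hc => hc.1⟩
  have hne : {C : ℝ | 1 ≤ C ∧ ∀ x y z : Y, e x y ≤ C * max (e x z) (e z y)}.Nonempty :=
    ⟨C, hC1, hC⟩
  refine ⟨le_csInf hne fun c hc => hc.1, fun x y z => ?_⟩
  rcases (le_max_of_le_left (h0 x z) : 0 ≤ max (e x z) (e z y)).eq_or_lt with h | h
  · have := hC x y z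
    rw [← h, mul_zero] at this ⊢
    exact this
  · rw [← div_le_iff₀ h]
    exact le_csInf hne fun c hc => (div_le_iff₀ h).2 (hc.2 x y z)

theorem exists_exponent {C s : ℝ} (hC : 1 ≤ C) (q : ℝ≥0∞)
    (h : C ^ s < 2 ∨ (q = ∞ ∧ C ^ s ≤ 2)) :
    ∃ α : ℝ, s ≤ α ∧ (q ≠ ∞ → s < α) ∧ C ^ α ≤ 2 := by
  rcases h with h | ⟨hq, h⟩
  · have hc : ContinuousAt (fun x : ℝ => C ^ x) s :=
      Real.continuousAt_const_rpow (by positivity)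
    have : ∀ᶠ x in nhdsWithin s (Ioi s), C ^ x < 2 :=
      (hc.eventually (gt_mem_nhds h)).filter_mono nhdsWithin_le_nhds
    obtain ⟨α, h1, h2⟩ := (this.and self_mem_nhdsWithin).exists
    exact ⟨α, le_of_lt h2, fun _ => h2, h1.le⟩
  · exact ⟨s, le_rfl, fun h' => absurd hq h', h⟩

theorem exists_metric {Y : Type*} (ρ : Y → Y → ℝ) (hρ : IsQuasiDist ρ) (s : ℝ) (hs : 0 < s)
    (q : ℝ≥0∞) (hind : SPrecIndex ρ s q) :
    ∃ (α K : ℝ) (_ : MetricSpace Y), s ≤ α ∧ (q ≠ ∞ → s < α) ∧ 1 ≤ K ∧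
      ∀ x y : Y, ρ x y ^ α ≤ K * dist x y ∧ dist x y ≤ K * ρ x y ^ α := by
  obtain ⟨ϱ, hϱ, ⟨c, hc1, hc⟩, hC⟩ := hind
  obtain ⟨hC1, hCq⟩ := Crho_spec hϱ
  obtain ⟨α, hsα, hsα', hα2⟩ := exists_exponent hC1 q hC
  have hα : 0 < α := hs.trans_le hsα
  obtain ⟨h0, hz, ⟨C₀, hC01, hC0⟩, -⟩ := hϱ
  have hm0 : ∀ x y, 0 ≤ max (ϱ x y) (ϱ y x) := fun x y => le_max_of_le_left (h0 x y)
  let e : Y → Y → NNReal := fun x y => ⟨max (ϱ x y) (ϱ y x) ^ α, Real.rpow_nonneg (hm0 x y) _⟩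
  have he : ∀ x y, (e x y : ℝ) = max (ϱ x y) (ϱ y x) ^ α := fun x y => rfl
  obtain ⟨I, hI⟩ := frink_metric e
    (fun x => by
      apply NNReal.eq
      rw [he, (hz x x).2 rfl, max_self, Real.zero_rpow hα.ne']; rfl)
    (fun x y => by apply NNReal.eq; rw [he, he, max_comm])
    (fun x y h => by
      have h1 : max (ϱ x y) (ϱ y x) ^ α = 0 := by rw [← he, h]; rfl
      rw [Real.rpow_eq_zero (hm0 x y) hα.ne'] at h1
      exact (hz x y).1 (le_antisymm (h1 ▸ le_max_left _ _) (h0 x y)))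
    (fun x y z => by
      have h1 : max (ϱ x z) (ϱ z x) ≤
          Crho ϱ * max (max (ϱ x y) (ϱ y x)) (max (ϱ y z) (ϱ z y)) := by
        refine max_le ((hCq x z y).trans ?_) ((hCq z x y).trans ?_)
        · exact mul_le_mul_of_nonneg_left
            (max_le_max (le_max_left _ _) (le_max_left _ _)) (by linarith)
        · exact mul_le_mul_of_nonneg_left (max_le (le_max_of_le_right (le_max_right _ _))
            (le_max_of_le_left (le_max_right _ _))) (by linarith)
      have h2 := Real.rpow_le_rpow (hm0 x z) h1 hα.le
      rw [Real.mul_rpow (by positivity) (le_max_of_le_left (hm0 x y))] at h2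
      have h3 : max (max (ϱ x y) (ϱ y x)) (max (ϱ y z) (ϱ z y)) ^ α
          = max ((e x y : ℝ)) (e y z) := by
        rw [he, he]
        exact (Real.monotoneOn_rpow_Ici_of_exponent_nonneg hα.le).map_max
          (mem_Ici.2 (hm0 x y)) (mem_Ici.2 (hm0 y z))
      rw [h3, ← he] at h2
      have h4 : (e x z : ℝ) ≤ 2 * max ((e x y : ℝ)) (e y z) :=
        h2.trans (mul_le_mul_of_nonneg_right hα2 (le_max_of_le_left (NNReal.coe_nonneg _)))
      exact_mod_cast h4)
  have hρ0 := hρ.1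
  have hc0 : 0 < c := by linarith
  have hC00 : 0 < C₀ := by linarith
  refine ⟨α, max (4 * c ^ α) ((C₀ * c) ^ α), I, hsα, hsα', ?_, fun x y => ⟨?_, ?_⟩⟩
  · refine le_max_of_le_left ?_
    have := Real.one_le_rpow hc1 hα.le
    linarith
  · have h1 : ρ x y ^ α ≤ c ^ α * e x y := by
      rw [he, ← Real.mul_rpow hc0.le (hm0 x y)]
      refine Real.rpow_le_rpow (hρ0 x y) ((hc x y).2.trans ?_) hα.le
      gcongr
      exact le_max_left _ _
    have h2 := (hI x y).2
    have h3 : (0 : ℝ) ≤ c ^ α := by positivity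
    calc ρ x y ^ α ≤ c ^ α * (4 * dist x y) := h1.trans (by gcongr)
      _ = 4 * c ^ α * dist x y := by ring
      _ ≤ _ := by gcongr; exact le_max_left _ _
  · refine (hI x y).1.trans ?_
    rw [he]
    have h1 : max (ϱ x y) (ϱ y x) ≤ C₀ * c * ρ x y := by
      have h2 : ϱ x y ≤ c * ρ x y := by
        have := (hc x y).1
        rwa [inv_mul_le_iff₀ hc0] at this
      have h3 : ϱ y x ≤ C₀ * ϱ x y := hC0 x y
      have h4 : C₀ * ϱ x y ≤ C₀ * (c * ρ x y) := by gcongr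
      have h5 : ϱ x y ≤ C₀ * ϱ x y := le_mul_of_one_le_left (h0 x y) hC01
      exact max_le (by linarith) (by linarith)
    have h2 := Real.rpow_le_rpow (hm0 x y) h1 hα.le
    rw [Real.mul_rpow (by positivity) (hρ0 x y)] at h2
    refine h2.trans ?_
    have := Real.rpow_nonneg (hρ0 x y) α
    gcongr
    exact le_max_right _ _

end Frink

section Sequences

theorem lqN_mono {q : ℝ≥0∞} {a c : ℤ → ℝ≥0∞} (h : ∀ k, a k ≤ c k) : lqN q a ≤ lqN q c := by
  unfold lqN
  split_ifs
  · exact iSup_mono h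
  · have := ENNReal.toReal_nonneg (a := q)
    gcongr with k
    exact h k

theorem lqN_const_mul {q : ℝ≥0∞} (hq : 0 < q) (m : ℝ≥0∞) (a : ℤ → ℝ≥0∞) :
    lqN q (fun k => m * a k) = m * lqN q a := by
  unfold lqN
  split_ifs with h
  · rw [ENNReal.mul_iSup]
  · have hq' : 0 < q.toReal := ENNReal.toReal_pos hq.ne' h
    simp_rw [ENNReal.mul_rpow_of_nonneg _ _ hq'.le]
    rw [ENNReal.tsum_mul_left, ENNReal.mul_rpow_of_nonneg _ _ (by positivity),
      ← ENNReal.rpow_mul, mul_one_div_cancel hq'.ne', ENNReal.rpow_one]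

theorem le_lqN {q : ℝ≥0∞} (hq : 0 < q) (a : ℤ → ℝ≥0∞) (k : ℤ) : a k ≤ lqN q a := by
  unfold lqN
  split_ifs with h
  · exact le_iSup a k
  · have hq' : 0 < q.toReal := ENNReal.toReal_pos hq.ne' h
    calc a k = (a k ^ q.toReal) ^ (1 / q.toReal) := by
          rw [← ENNReal.rpow_mul, mul_one_div_cancel hq'.ne', ENNReal.rpow_one]
      _ ≤ _ := by
          gcongr
          exact ENNReal.le_tsum (f := fun k => a k ^ q.toReal) k

theorem measurable_lqN {Y : Type*} [MeasurableSpace Y] (q : ℝ≥0∞) {g : ℤ → Y → ℝ≥0∞}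
    (hg : ∀ k, Measurable (g k)) : Measurable fun x => lqN q fun k => g k x := by
  unfold lqN
  split_ifs with h
  · exact Measurable.iSup hg
  · exact (Measurable.tsum fun k => (hg k).pow_const _).pow_const _

/-- Supremum over a finite family of sequences. -/
theorem lqN_finset_sup {ι : Type*} {q : ℝ≥0∞} (A : Finset ι) (a : ι → ℤ → ℝ≥0∞)
    {M : ℝ≥0∞} (hM : ∀ i ∈ A, lqN q (a i) ≤ M) (hq : 0 < q) {N : ℕ} (hN : A.card ≤ N) :
    lqN q (fun k => ⨆ i ∈ A, a i k) ≤ max 1 ((N : ℝ≥0∞) ^ (1 / q.toReal)) * M := by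
  unfold lqN at hM ⊢
  split_ifs at hM ⊢ with h
  · refine le_trans ?_ (mul_le_mul_left (le_max_left _ _) _)
    rw [one_mul]
    exact iSup_le fun k => iSup₂_le fun i hi => (le_iSup (a i) k).trans (hM i hi)
  · have hq' : 0 < q.toReal := ENNReal.toReal_pos hq.ne' h
    have hM' : ∀ i ∈ A, ∑' k, a i k ^ q.toReal ≤ M ^ q.toReal := fun i hi => by
      have := ENNReal.rpow_le_rpow (hM i hi) hq'.le
      rwa [← ENNReal.rpow_mul, one_div_mul_cancel hq'.ne', ENNReal.rpow_one] at this
    have h1 : ∀ k, (⨆ i ∈ A, a i k) ^ q.toReal ≤ ∑ i ∈ A, a i k ^ q.toReal := fun k => by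
      rw [← ENNReal.le_rpow_inv_iff hq']
      refine iSup₂_le fun i hi => ?_
      rw [ENNReal.le_rpow_inv_iff hq']
      exact Finset.single_le_sum (f := fun i => a i k ^ q.toReal) (fun _ _ => zero_le) hi
    calc (∑' k, (⨆ i ∈ A, a i k) ^ q.toReal) ^ (1 / q.toReal)
        ≤ (N * M ^ q.toReal) ^ (1 / q.toReal) := by
          gcongr
          calc ∑' k, (⨆ i ∈ A, a i k) ^ q.toReal ≤ ∑' k, ∑ i ∈ A, a i k ^ q.toReal := by
                gcongr with k; exact h1 k
            _ = ∑ i ∈ A, ∑' k, a i k ^ q.toReal :=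
                Summable.tsum_finsetSum fun _ _ => ENNReal.summable
            _ ≤ ∑ i ∈ A, M ^ q.toReal := Finset.sum_le_sum hM'
            _ ≤ N * M ^ q.toReal := by
                rw [Finset.sum_const, nsmul_eq_mul]; gcongr
      _ = (N : ℝ≥0∞) ^ (1 / q.toReal) * M := by
          rw [ENNReal.mul_rpow_of_nonneg _ _ (by positivity), ← ENNReal.rpow_mul,
            mul_one_div_cancel hq'.ne', ENNReal.rpow_one]
      _ ≤ _ := by gcongr; exact le_max_right _ _

/-- The modulus attached to a sequence of gradients. -/
def modu (b β : ℝ) (a : ℤ → ℝ≥0∞) (t : ℝ) : ℝ≥0∞ :=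
  ⨆ j : ℤ, ENNReal.ofReal (min 1 (t * b ^ j)) * (ENNReal.ofReal (β ^ (-j)) * a j)

theorem modu_mono {b β : ℝ} (hb : 0 < b) {a c : ℤ → ℝ≥0∞} (h : ∀ k, a k ≤ c k) {t t' : ℝ}
    (ht : t ≤ t') : modu b β a t ≤ modu b β c t' := by
  unfold modu
  gcongr with j
  exact h j

theorem modu_mul_le {b β : ℝ} (hb : 0 < b) (a : ℤ → ℝ≥0∞) {m t : ℝ} (hm : 1 ≤ m) (ht : 0 ≤ t) :
    modu b β a (m * t) ≤ ENNReal.ofReal m * modu b β a t := by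
  unfold modu
  rw [ENNReal.mul_iSup]
  refine iSup_mono fun j => ?_
  have : 0 ≤ t * b ^ j := by positivity
  rw [← mul_assoc (ENNReal.ofReal m), ← ENNReal.ofReal_mul (by positivity)]
  refine mul_le_mul_left (ENNReal.ofReal_le_ofReal ?_) _
  rw [mul_min_of_nonneg _ _ (by positivity), mul_assoc]
  exact min_le_min_right _ (by linarith)

theorem term_le_modu {b β : ℝ} (hb : 0 < b) (a : ℤ → ℝ≥0∞) {L t : ℝ} (hL : 1 ≤ L)
    (k : ℤ) (hk : b ^ (-k) ≤ L * t) :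
    ENNReal.ofReal (β ^ (-k)) * a k ≤ ENNReal.ofReal L * modu b β a t := by
  refine le_trans ?_ (mul_le_mul_right (le_iSup (fun j : ℤ => ENNReal.ofReal (min 1 (t * b ^ j)) *
    (ENNReal.ofReal (β ^ (-j)) * a j)) k) _)
  rw [← mul_assoc, ← ENNReal.ofReal_mul (by positivity)]
  have hbk : 0 < b ^ k := by positivity
  have : 1 ≤ L * min 1 (t * b ^ k) := by
    rw [mul_min_of_nonneg _ _ (by positivity), mul_one, ← mul_assoc]
    refine le_min hL ?_
    rw [zpow_neg, inv_le_iff_one_le_mul₀ hbk] at hk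
    exact hk
  calc ENNReal.ofReal (β ^ (-k)) * a k = ENNReal.ofReal 1 * (ENNReal.ofReal (β ^ (-k)) * a k) := by
        simp
    _ ≤ _ := by gcongr

theorem ofReal_mul_le_modu {b β : ℝ} (a : ℤ → ℝ≥0∞) {t : ℝ} (ht : t ≤ 1) :
    ENNReal.ofReal t * a 0 ≤ modu b β a t := by
  refine le_trans ?_ (le_iSup (fun j : ℤ => ENNReal.ofReal (min 1 (t * b ^ j)) *
    (ENNReal.ofReal (β ^ (-j)) * a j)) 0)
  simp [min_eq_right ht]

theorem kernel_le {b β θ : ℝ} (hβ : 1 < β) (hβb : β ≤ b) (h1 : β⁻¹ ≤ θ) (h2 : β / b ≤ θ)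
    (i : ℤ) : min 1 (b ^ i) * β ^ (-i) ≤ θ ^ i.natAbs := by
  have hβ0 : 0 < β := by linarith
  have hb0 : 0 < b := by linarith
  rcases le_total 0 i with hi | hi
  · lift i to ℕ using hi
    rw [Int.natAbs_natCast]
    calc min 1 (b ^ (i : ℤ)) * β ^ (-(i : ℤ)) ≤ 1 * β ^ (-(i : ℤ)) := by
          gcongr; exact min_le_left _ _
      _ = (β⁻¹) ^ i := by rw [zpow_neg, zpow_natCast, one_mul, inv_pow]
      _ ≤ θ ^ i := by gcongr
  · obtain ⟨n, rfl⟩ : ∃ n : ℕ, i = -(n : ℤ) := ⟨i.natAbs, by omega⟩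
    rw [Int.natAbs_neg, Int.natAbs_natCast, neg_neg]
    calc min 1 (b ^ (-(n : ℤ))) * β ^ (n : ℤ) ≤ b ^ (-(n : ℤ)) * β ^ (n : ℤ) := by
          gcongr; exact min_le_right _ _
      _ = (β / b) ^ n := by rw [zpow_neg, zpow_natCast, zpow_natCast, div_pow]; ring
      _ ≤ θ ^ n := by gcongr

theorem tsum_int_pow_natAbs_lt_top {θ : ℝ≥0∞} (h : θ < 1) : ∑' i : ℤ, θ ^ i.natAbs < ∞ := by
  have h1 : ∑' n : ℕ, θ ^ n < ∞ := by
    rw [ENNReal.tsum_geometric, ENNReal.inv_lt_top]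
    exact tsub_pos_of_lt h
  have hle : ∑' i : ℤ, θ ^ i.natAbs ≤ ∑' n : ℕ, θ ^ n + ∑' n : ℕ, θ ^ n := by
    rw [tsum_of_nat_of_neg_add_one (f := fun i : ℤ => θ ^ i.natAbs)
      ENNReal.summable ENNReal.summable]
    refine add_le_add (ENNReal.tsum_le_tsum fun n => by simp) (ENNReal.tsum_le_tsum fun n => ?_)
    · have : (-((n : ℤ) + 1)).natAbs = n + 1 := by omega
      rw [this]
      exact pow_le_pow_right_of_le_one' h.le (Nat.le_succ n)
  exact hle.trans_lt (ENNReal.add_lt_top.2 ⟨h1, h1⟩)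

theorem rescaled_modu_le {b β θ : ℝ} (hβ : 1 < β) (hβb : β ≤ b) (h1 : β⁻¹ ≤ θ) (h2 : β / b ≤ θ)
    (a : ℤ → ℝ≥0∞) (k : ℤ) :
    ENNReal.ofReal (β ^ k) * modu b β a (b ^ (-k)) ≤
      ⨆ i : ℤ, ENNReal.ofReal θ ^ i.natAbs * a (k + i) := by
  have hβ0 : 0 < β := by linarith
  have hb0 : 0 < b := by linarith
  have hθ : 0 ≤ θ := le_trans (by positivity) h1
  unfold modu
  rw [ENNReal.mul_iSup]
  refine iSup_le fun j => le_trans ?_ (le_iSup (fun i : ℤ => ENNReal.ofReal θ ^ i.natAbs * a (k + i)) (j - k))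
  rw [add_sub_cancel, ← mul_assoc, ← mul_assoc, ← ENNReal.ofReal_mul (by positivity),
    ← ENNReal.ofReal_mul (by positivity), ← ENNReal.ofReal_pow hθ]
  gcongr
  refine le_trans (le_of_eq ?_) (kernel_le hβ hβb h1 h2 (j - k))
  rw [← zpow_add₀ hb0.ne', neg_add_eq_sub, mul_comm (β ^ k), mul_assoc, ← zpow_add₀ hβ0.ne']
  congr 2
  ring

/-- The rescaled modulus is controlled in `ℓ^q`. -/
theorem exists_lqN_modu_le {b β : ℝ} (hβ : 1 < β) (hβb : β ≤ b) {q : ℝ≥0∞} (hq : 0 < q)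
    (hqb : q ≠ ∞ → β < b) :
    ∃ C : ℝ≥0∞, C ≠ ∞ ∧ ∀ a : ℤ → ℝ≥0∞,
      lqN q (fun k => ENNReal.ofReal (β ^ k) * modu b β a (b ^ (-k))) ≤ C * lqN q a := by
  have hβ0 : 0 < β := by linarith
  have hb0 : 0 < b := by linarith
  set θ := max β⁻¹ (β / b) with hθ
  have h1 : β⁻¹ ≤ θ := le_max_left _ _
  have h2 : β / b ≤ θ := le_max_right _ _
  have hθ1 : θ ≤ 1 := max_le (inv_le_one_of_one_le₀ hβ.le) ((div_le_one hb0).2 hβb)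
  by_cases hqt : q = ∞
  · refine ⟨1, by simp, fun a => ?_⟩
    rw [one_mul, lqN, lqN, if_pos hqt, if_pos hqt]
    refine iSup_le fun k => (rescaled_modu_le hβ hβb h1 h2 a k).trans (iSup_le fun i => ?_)
    calc ENNReal.ofReal θ ^ i.natAbs * a (k + i) ≤ 1 * a (k + i) := by
          gcongr
          exact pow_le_one₀ zero_le (by simpa using hθ1)
      _ ≤ _ := by rw [one_mul]; exact le_iSup a _
  · have hq' : 0 < q.toReal := ENNReal.toReal_pos hq.ne' hqt
    have hθlt : θ < 1 := max_lt (inv_lt_one_of_one_lt₀ hβ) ((div_lt_one hb0).2 (hqb hqt))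
    set τ := ENNReal.ofReal θ ^ q.toReal with hτ
    have hτ1 : τ < 1 := ENNReal.rpow_lt_one (by simpa using hθlt) hq'
    set S := ∑' i : ℤ, τ ^ i.natAbs with hS
    have hSt : S < ∞ := tsum_int_pow_natAbs_lt_top hτ1
    refine ⟨S ^ (1 / q.toReal), ENNReal.rpow_ne_top_of_nonneg (by positivity) hSt.ne, fun a => ?_⟩
    rw [lqN, lqN, if_neg hqt, if_neg hqt, ← ENNReal.mul_rpow_of_nonneg _ _ (by positivity)]
    gcongr
    calc ∑' k : ℤ, (ENNReal.ofReal (β ^ k) * modu b β a (b ^ (-k))) ^ q.toReal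
        ≤ ∑' k : ℤ, ∑' i : ℤ, τ ^ i.natAbs * a (k + i) ^ q.toReal := by
          gcongr with k
          rw [← ENNReal.le_rpow_inv_iff hq']
          refine (rescaled_modu_le hβ hβb h1 h2 a k).trans (iSup_le fun i => ?_)
          rw [ENNReal.le_rpow_inv_iff hq', ENNReal.mul_rpow_of_nonneg _ _ hq'.le]
          refine le_trans (le_of_eq ?_) (ENNReal.le_tsum i)
          congr 1
          rw [hτ, ← ENNReal.rpow_natCast, ← ENNReal.rpow_natCast, ← ENNReal.rpow_mul,
            ← ENNReal.rpow_mul, mul_comm]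
      _ = ∑' i : ℤ, τ ^ i.natAbs * ∑' k : ℤ, a k ^ q.toReal := by
          rw [ENNReal.tsum_comm]
          refine tsum_congr fun i => ?_
          rw [ENNReal.tsum_mul_left]
          congr 1
          exact (Equiv.addRight i).tsum_eq (fun k => a k ^ q.toReal)
      _ = S * ∑' k : ℤ, a k ^ q.toReal := ENNReal.tsum_mul_right

end Sequences

section Vitali

/-- A measure on a metric space with positive finite balls and doubling constant `D`. -/
structure IsMetricDoubling {Y : Type*} [MetricSpace Y] [MeasurableSpace Y] (μ : Measure Y)
    (D : ℝ≥0∞) : Prop where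
  ne_top : D ≠ ∞
  pos : ∀ (x : Y) (r : ℝ), 0 < r → 0 < μ (Metric.ball x r)
  lt_top : ∀ (x : Y) (r : ℝ), μ (Metric.ball x r) < ∞
  doubling : ∀ (x : Y) (r : ℝ), 0 < r → μ (Metric.ball x (2 * r)) ≤ D * μ (Metric.ball x r)

variable {Y : Type*} [MetricSpace Y] [MeasurableSpace Y] {μ : Measure Y} {D : ℝ≥0∞}

theorem IsMetricDoubling.ball_pow (hμ : IsMetricDoubling μ D) (x : Y) {r : ℝ} (hr : 0 < r)
    (n : ℕ) : μ (Metric.ball x (2 ^ n * r)) ≤ D ^ n * μ (Metric.ball x r) := by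
  induction n with
  | zero => simp
  | succ n ih =>
    calc μ (Metric.ball x (2 ^ (n + 1) * r)) = μ (Metric.ball x (2 * (2 ^ n * r))) := by
          congr 2; ring
      _ ≤ D * μ (Metric.ball x (2 ^ n * r)) := hμ.doubling x _ (by positivity)
      _ ≤ D * (D ^ n * μ (Metric.ball x r)) := by gcongr
      _ = _ := by rw [pow_succ']; ring

theorem IsMetricDoubling.vitali [OpensMeasurableSpace Y] [SecondCountableTopology Y]
    (hμ : IsMetricDoubling μ D) {ι : Type*} (T : Set ι) (p : ι → Y) (r : ι → ℝ) (R : ℝ)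
    (hr : ∀ i ∈ T, 0 < r i ∧ r i ≤ R) (n : ℕ) (K : ℝ≥0∞) (A : Set Y)
    (hA : ∀ i ∈ T, μ (Metric.ball (p i) (r i)) ≤ K * μ (Metric.ball (p i) (r i) ∩ A)) :
    μ (⋃ i ∈ T, Metric.ball (p i) (2 ^ n * r i)) ≤ D ^ (n + 2) * K * μ A := by
  obtain ⟨u, huT, hdisj, hcov⟩ := Vitali.exists_disjoint_subfamily_covering_enlargement_ball T p
    (fun i => 2 ^ n * r i) (2 ^ n * R) (fun i hi => by have := (hr i hi).2; gcongr) 4 (by norm_num)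
  have hu : u.Countable := hdisj.countable_of_isOpen (fun _ _ => Metric.isOpen_ball) fun i hi =>
    Metric.nonempty_ball.2 (by have := (hr i (huT hi)).1; positivity)
  have hsmall : ∀ i ∈ u, Metric.ball (p i) (r i) ⊆ Metric.ball (p i) (2 ^ n * r i) := fun i hi =>
    Metric.ball_subset_ball (le_mul_of_one_le_left (hr i (huT hi)).1.le (one_le_pow₀ (by norm_num)))
  calc μ (⋃ i ∈ T, Metric.ball (p i) (2 ^ n * r i))
      ≤ μ (⋃ i ∈ u, Metric.ball (p i) (2 ^ (n + 2) * r i)) := by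
        refine measure_mono (iUnion₂_subset fun i hi => ?_)
        obtain ⟨j, hj, hij⟩ := hcov i hi
        refine hij.trans (subset_biUnion_of_mem (u := fun j => Metric.ball (p j) (2 ^ (n + 2) * r j))
          hj |>.trans' (Metric.ball_subset_ball (le_of_eq ?_)))
        ring
    _ ≤ ∑' i : u, μ (Metric.ball (p i) (2 ^ (n + 2) * r i)) := measure_biUnion_le μ hu _
    _ ≤ ∑' i : u, D ^ (n + 2) * K * μ.restrict A (Metric.ball (p i) (r i)) := by
        gcongr with i
        rw [Measure.restrict_apply Metric.isOpen_ball.measurableSet, mul_assoc]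
        exact (hμ.ball_pow _ (hr i (huT i.2)).1 _).trans (by gcongr; exact hA i (huT i.2))
    _ = D ^ (n + 2) * K * μ.restrict A (⋃ i ∈ u, Metric.ball (p i) (r i)) := by
        rw [ENNReal.tsum_mul_left, measure_biUnion hu (fun i hi j hj hij =>
          (hdisj hi hj hij).mono (hsmall i hi) (hsmall j hj))
          fun i _ => Metric.isOpen_ball.measurableSet]
    _ ≤ _ := by
        exact mul_le_mul_right
          ((measure_mono (subset_univ _)).trans (Measure.restrict_apply_univ A).le) _

end Vitali

section Transfer

variable {Y : Type*} [MetricSpace Y] {ρ : Y → Y → ℝ} {α K : ℝ}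

theorem ball_subset_qball (hα : 0 < α) (h0 : ∀ x y, 0 ≤ ρ x y)
    (h : ∀ x y : Y, ρ x y ^ α ≤ K * dist x y) (hK : 0 < K) (x : Y) {r : ℝ} (hr : 0 < r) :
    Metric.ball x r ⊆ qball ρ x ((K * r) ^ α⁻¹) := by
  intro y hy
  change ρ x y < _
  rw [Real.lt_rpow_inv_iff_of_pos (h0 x y) (by positivity) hα]
  refine (h x y).trans_lt ?_
  rw [Metric.mem_ball'] at hy
  gcongr

theorem qball_subset_ball (hα : 0 < α) (h0 : ∀ x y, 0 ≤ ρ x y)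
    (h : ∀ x y : Y, dist x y ≤ K * ρ x y ^ α) (hK : 0 < K) (x : Y) {r : ℝ} (hr : 0 < r) :
    qball ρ x ((r / K) ^ α⁻¹) ⊆ Metric.ball x r := by
  intro y hy
  change ρ x y < _ at hy
  rw [Real.lt_rpow_inv_iff_of_pos (h0 x y) (by positivity) hα, lt_div_iff₀ hK] at hy
  rw [Metric.mem_ball']
  exact (h x y).trans_lt (by linarith)

variable [MeasurableSpace Y] {μ : Measure Y}

omit [MetricSpace Y] in
theorem sigmaFinite_of_isQMMS (hX : IsQMMS ρ μ) : SigmaFinite μ := by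
  obtain ⟨x₀, -, -⟩ := hX.nontrivial
  refine ⟨⟨{ set := fun n : ℕ => qball ρ x₀ (n + 1), set_mem := fun _ => trivial,
             finite := fun n => hX.ball_lt_top _ _ (by positivity), spanning := ?_ }⟩⟩
  refine iUnion_eq_univ_iff.2 fun y => ?_
  obtain ⟨n, hn⟩ := exists_nat_gt (ρ x₀ y)
  exact ⟨n, show ρ x₀ y < n + 1 by linarith⟩

theorem secondCountable_of_isQMMS (hX : IsQMMS ρ μ) (hα : 0 < α) (hK : 0 < K)
    (h : ∀ x y : Y, dist x y ≤ K * ρ x y ^ α) : SecondCountableTopology Y := by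
  have := sigmaFinite_of_isQMMS hX
  refine Metric.secondCountable_of_almost_dense_set fun ε hε => ?_
  obtain ⟨u, -, hdisj, hcov⟩ := Vitali.exists_disjoint_subfamily_covering_enlargement_ball
    (univ : Set Y) id (fun _ => ε / 4) (ε / 4) (fun _ _ => le_rfl) 4 (by norm_num)
  have hε4 : 0 < ε / 4 := by positivity
  refine ⟨u, ?_, fun x => ?_⟩
  · have hpos : ∀ i : u, 0 < μ (qball ρ (i : Y) ((ε / 4 / K) ^ α⁻¹)) := fun i =>
      hX.ball_pos _ _ (by positivity)
    have := Measure.countable_meas_pos_of_disjoint_iUnion (μ := μ)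
      (As := fun i : u => qball ρ (i : Y) ((ε / 4 / K) ^ α⁻¹))
      (fun i => hX.measurableSet_ball _ _ (by positivity))
      (fun i j hij => (hdisj i.2 j.2 (fun h => hij (Subtype.ext h))).mono
        (qball_subset_ball hα hX.quasi.1 h hK _ hε4) (qball_subset_ball hα hX.quasi.1 h hK _ hε4))
    rw [show {i : u | 0 < μ (qball ρ (i : Y) ((ε / 4 / K) ^ α⁻¹))} = univ from
      eq_univ_of_forall hpos] at this
    exact countable_coe_iff.1 (countable_univ_iff.1 this)
  · obtain ⟨y, hy, hxy⟩ := hcov x (mem_univ x)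
    refine ⟨y, hy, ?_⟩
    have : x ∈ Metric.ball y (4 * (ε / 4)) := hxy (Metric.mem_ball_self hε4)
    rw [Metric.mem_ball] at this
    linarith

theorem opensMeasurable_of_isQMMS (hX : IsQMMS ρ μ) (hα : 0 < α) (hK : 0 < K)
    (h' : ∀ x y : Y, ρ x y ^ α ≤ K * dist x y)
    (h : ∀ x y : Y, dist x y ≤ K * ρ x y ^ α) : OpensMeasurableSpace Y := by
  have := secondCountable_of_isQMMS hX hα hK h
  obtain ⟨s, hsc, hsd⟩ := TopologicalSpace.exists_countable_dense Y
  refine ⟨MeasurableSpace.generateFrom_le fun U hU => ?_⟩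
  have hUeq : U = ⋃ z ∈ s, ⋃ r : ℚ, ⋃ _ : 0 < (r : ℝ) ∧ qball ρ z r ⊆ U, qball ρ z r := by
    refine Subset.antisymm (fun x hx => ?_)
      (iUnion₂_subset fun z _ => iUnion₂_subset fun r hr => hr.2)
    obtain ⟨ε, hε, hεU⟩ := Metric.isOpen_iff.1 hU x hx
    obtain ⟨r, hr0, hr⟩ := exists_rat_btwn (show (0 : ℝ) < (ε / 2 / K) ^ α⁻¹ by positivity)
    have ht : 0 < min (ε / 2) ((r : ℝ) ^ α / K) := by positivity
    obtain ⟨z, hzs, hz⟩ := hsd.exists_dist_lt x ht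
    refine mem_biUnion hzs (mem_iUnion₂.2 ⟨r, ⟨hr0, fun y hy => hεU ?_⟩, ?_⟩)
    · have : y ∈ Metric.ball z (ε / 2) :=
        qball_subset_ball hα hX.quasi.1 h hK z (by positivity) (lt_trans hy hr)
      rw [Metric.mem_ball] at this ⊢
      have h1 := hz.trans_le (min_le_left _ _)
      rw [dist_comm] at h1
      linarith [dist_triangle y z x]
    · have h1 : x ∈ Metric.ball z ((r : ℝ) ^ α / K) := hz.trans_le (min_le_right _ _)
      have h2 := ball_subset_qball hα hX.quasi.1 h' hK z (by positivity) h1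
      rwa [mul_div_cancel₀ _ hK.ne', Real.rpow_rpow_inv hr0.le hα.ne'] at h2
  rw [hUeq]
  exact MeasurableSet.biUnion hsc fun z _ => MeasurableSet.iUnion fun r =>
    MeasurableSet.iUnion fun hr => hX.measurableSet_ball _ _ hr.1

omit [MetricSpace Y] in
theorem exists_qball_comparison {Q : ℝ} (hdoub : QDoubling ρ μ Q) (hα : 0 < α) (hK : 0 < K)
    {m : ℝ} (hm : K⁻¹ ≤ m) :
    ∃ M : ℝ≥0∞, M ≠ ∞ ∧ ∀ (x : Y) (r : ℝ), 0 < r →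
      μ (qball ρ x ((m * r) ^ α⁻¹)) ≤ M * μ (qball ρ x ((r / K) ^ α⁻¹)) := by
  obtain ⟨κ, hκ, hd⟩ := hdoub
  have hm0 : 0 < m := lt_of_lt_of_le (by positivity) hm
  set c := κ * ((K⁻¹ / m) ^ α⁻¹) ^ Q with hc
  have hc0 : 0 < c := by positivity
  refine ⟨(ENNReal.ofReal c)⁻¹, by simpa using hc0, fun x r hr => ?_⟩
  have hle : (r / K) ^ α⁻¹ ≤ (m * r) ^ α⁻¹ := by
    refine Real.rpow_le_rpow (by positivity) ?_ (by positivity)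
    rw [div_eq_inv_mul]; gcongr
  have h1 := hd x x ((r / K) ^ α⁻¹) ((m * r) ^ α⁻¹) (by positivity) hle
    (fun y hy => lt_of_lt_of_le hy hle)
  have h2 : κ * ((r / K) ^ α⁻¹ / (m * r) ^ α⁻¹) ^ Q = c := by
    rw [hc, ← Real.div_rpow (by positivity) (by positivity)]
    congr 3
    field_simp
  rw [h2] at h1
  rw [← ENNReal.mul_le_mul_iff_right (a := ENNReal.ofReal c) (by simpa using hc0) (by simp),
    ← mul_assoc, ENNReal.mul_inv_cancel (by simpa using hc0) (by simp), one_mul]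
  exact h1

theorem exists_metricDoubling {Q : ℝ} (hX : IsQMMS ρ μ) (hdoub : QDoubling ρ μ Q) (hα : 0 < α)
    (hK : 1 ≤ K) (h' : ∀ x y : Y, ρ x y ^ α ≤ K * dist x y)
    (h : ∀ x y : Y, dist x y ≤ K * ρ x y ^ α) : ∃ D, IsMetricDoubling μ D := by
  have hK0 : 0 < K := by linarith
  have hin := fun x r hr => ball_subset_qball (r := r) hα hX.quasi.1 h' hK0 x hr
  have hout := fun x r hr => qball_subset_ball (r := r) hα hX.quasi.1 h hK0 x hr
  obtain ⟨M, hM, hMle⟩ := exists_qball_comparison (m := K * 2) hdoub hα hK0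
    ((inv_le_one_of_one_le₀ hK).trans (by linarith))
  refine ⟨M, hM, fun x r hr => ?_, fun x r => ?_, fun x r hr => ?_⟩
  · exact (hX.ball_pos _ _ (by positivity)).trans_le (measure_mono (hout x r hr))
  · rcases le_or_gt r 0 with hr | hr
    · simp [Metric.ball_eq_empty.2 hr]
    · exact (measure_mono (hin x r hr)).trans_lt (hX.ball_lt_top _ _ (by positivity))
  · calc μ (Metric.ball x (2 * r)) ≤ μ (qball ρ x ((K * 2 * r) ^ α⁻¹)) := by
          rw [mul_assoc]; exact measure_mono (hin x (2 * r) (by positivity))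
      _ ≤ M * μ (qball ρ x ((r / K) ^ α⁻¹)) := hMle x r hr
      _ ≤ _ := by gcongr; exact hout x r hr

theorem exists_metricDensity {Q : ℝ} (hX : IsQMMS ρ μ) (hdoub : QDoubling ρ μ Q) (hα : 0 < α)
    (hK : 1 ≤ K) (h' : ∀ x y : Y, ρ x y ^ α ≤ K * dist x y)
    (h : ∀ x y : Y, dist x y ≤ K * ρ x y ^ α) {Ω : Set Y} (hΩ : MeasDensity ρ μ Ω) :
    ∃ K' : ℝ≥0∞, K' ≠ ∞ ∧ ∀ x ∈ Ω, ∀ r : ℝ, 0 < r → r ≤ 1 →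
      μ (Metric.ball x r) ≤ K' * μ (Metric.ball x r ∩ Ω) := by
  have hK0 : 0 < K := by linarith
  obtain ⟨M, hM, hMle⟩ := exists_qball_comparison (m := K) hdoub hα hK0
    ((inv_le_one_of_one_le₀ hK).trans hK)
  obtain ⟨c, hc, hden⟩ := hΩ
  refine ⟨M * ENNReal.ofReal c, by finiteness, fun x hx r hr hr1 => ?_⟩
  have hle : (r / K) ^ α⁻¹ ≤ 1 :=
    Real.rpow_le_one (by positivity) ((div_le_one hK0).2 (by linarith)) (by positivity)
  calc μ (Metric.ball x r) ≤ μ (qball ρ x ((K * r) ^ α⁻¹)) :=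
        measure_mono (ball_subset_qball hα hX.quasi.1 h' hK0 x hr)
    _ ≤ M * μ (qball ρ x ((r / K) ^ α⁻¹)) := hMle x r hr
    _ ≤ M * (ENNReal.ofReal c * μ (qball ρ x ((r / K) ^ α⁻¹) ∩ Ω)) := by
        gcongr; exact hden x hx _ (by positivity) hle
    _ ≤ _ := by
        rw [mul_assoc]; gcongr
        exact qball_subset_ball hα hX.quasi.1 h hK0 x hr

end Transfer

section EssInf

variable {Y : Type*} [MeasurableSpace Y] {ν : Measure Y} {F A : Set Y}

/-- `A` meets every non-null measurable subset of `F` in a set of positive outer measure. -/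
def HullFull (ν : Measure Y) (F A : Set Y) : Prop :=
  ∀ V ⊆ F, MeasurableSet V → ν (V ∩ A) = 0 → ν V = 0

theorem exists_essInf [SigmaFinite ν] (hA : HullFull ν F A)
    (ψ : Y → ℝ≥0∞) (hψ : ∀ a ∈ A, ψ a ≠ ∞) :
    ∃ φ : Y → ℝ≥0∞, Measurable φ ∧ (∀ a ∈ A, φ a ≤ ψ a) ∧
      ∀ f : Y → ℝ≥0∞, Measurable f → (∀ x, 0 < f x) →
        HullFull ν F {a ∈ A | ψ a < φ a + f a} := by
  classical
  let c : ℚ → ℝ≥0∞ := fun r => ((r : ℝ).toNNReal : ℝ≥0∞)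
  let H : ℚ → Set Y := fun r => toMeasurable ν (A ∩ {x | ψ x < c r})
  have hH : ∀ r, MeasurableSet (H r) := fun r => measurableSet_toMeasurable _ _
  let φ : Y → ℝ≥0∞ := fun x => ⨅ r : ℚ, if x ∈ H r then c r else ∞
  have hφ : Measurable φ := Measurable.iInf fun r =>
    Measurable.ite (hH r) measurable_const measurable_const
  have hle : ∀ a ∈ A, φ a ≤ ψ a := fun a ha => by
    refine le_of_forall_gt fun t ht => ?_
    obtain ⟨r, -, h1, h2⟩ := ENNReal.lt_iff_exists_rat_btwn.1 ht
    refine lt_of_le_of_lt (iInf_le _ r) ?_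
    have : a ∈ H r := subset_toMeasurable _ _ ⟨ha, h1⟩
    rwa [if_pos this]
  refine ⟨φ, hφ, hle, fun f hf hf0 V hVF hV hnull => ?_⟩
  let G : ℚ → Set Y := fun r => V ∩ ({x | φ x < c r} ∩ {x | c r < φ x + f x})
  have hG : ∀ r, MeasurableSet (G r) := fun r =>
    hV.inter ((measurableSet_lt hφ measurable_const).inter
      (measurableSet_lt measurable_const (hφ.add hf)))
  have hGH : ∀ r r', c r' < c r → ν (H r' ∩ G r) = 0 := fun r r' hrr => by
    rw [Measure.measure_toMeasurable_inter_of_sFinite (hG r)]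
    refine measure_mono_null ?_ hnull
    rintro x ⟨⟨hxA, hx⟩, hxV, -, hx2⟩
    exact ⟨hxV, hxA, (lt_trans hx hrr).trans hx2⟩
  have hG0 : ∀ r, ν (G r) = 0 := fun r => by
    refine measure_mono_null (t := ⋃ r', ⋃ _ : c r' < c r, H r' ∩ G r) (fun x hx => ?_)
      (measure_iUnion_null fun r' => measure_iUnion_null fun h => hGH r r' h)
    obtain ⟨r', hr'⟩ := iInf_lt_iff.1 (show φ x < c r from hx.2.1)
    by_cases hxr : x ∈ H r'
    · rw [if_pos hxr] at hr'
      exact mem_iUnion₂.2 ⟨r', hr', hxr, hx⟩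
    · rw [if_neg hxr] at hr'
      exact absurd hr' not_top_lt
  have hI : ν (V ∩ {x | φ x = ∞}) = 0 := by
    refine hA _ (inter_subset_left.trans hVF) (hV.inter (hφ (measurableSet_singleton _))) ?_
    rw [show V ∩ {x | φ x = ∞} ∩ A = ∅ from ?_, measure_empty]
    refine eq_empty_of_forall_notMem fun x hx => hψ x hx.2 ?_
    have := hle x hx.2
    rw [show φ x = ∞ from hx.1.2] at this
    exact top_le_iff.1 this
  refine measure_mono_null (t := (V ∩ {x | φ x = ∞}) ∪ ⋃ r, G r) (fun x hx => ?_)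
    (measure_union_null hI (measure_iUnion_null hG0))
  by_cases hx1 : φ x = ∞
  · exact Or.inl ⟨hx, hx1⟩
  · obtain ⟨r, -, h1, h2⟩ := ENNReal.lt_iff_exists_rat_btwn.1
      (ENNReal.lt_add_right hx1 (hf0 x).ne')
    exact Or.inr (mem_iUnion.2 ⟨r, hx, h1, h2⟩)

theorem HullFull.support (hA : HullFull ν F A) (hF : MeasurableSet F) {T : Type*}
    [TopologicalSpace T] [SecondCountableTopology T] [MeasurableSpace T] [OpensMeasurableSpace T]
    {Θ : Y → T} (hΘ : Measurable Θ) :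
    ν {x ∈ F | ¬ ∀ U ∈ nhds (Θ x), ∃ a ∈ A ∩ F, Θ a ∈ U} = 0 := by
  let 𝓑 := TopologicalSpace.countableBasis T
  refine measure_mono_null
    (t := ⋃ B ∈ 𝓑, ⋃ _ : (F ∩ Θ ⁻¹' B) ∩ A = ∅, F ∩ Θ ⁻¹' B) (fun x hx => ?_)
    ((measure_biUnion_null_iff (TopologicalSpace.countable_countableBasis T)).2 fun B hB =>
      measure_iUnion_null fun h => hA _ inter_subset_left (hF.inter (hΘ
        (TopologicalSpace.isOpen_of_mem_countableBasis hB).measurableSet)) (by rw [h, measure_empty]))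
  obtain ⟨hxF, hx⟩ := hx
  push Not at hx
  obtain ⟨U, hU, hUa⟩ := hx
  obtain ⟨B, hB, hxB, hBU⟩ :=
    (TopologicalSpace.isBasis_countableBasis T).mem_nhds_iff.1 hU
  refine mem_biUnion hB (mem_iUnion.2 ⟨eq_empty_of_forall_notMem ?_, hxF, hxB⟩)
  rintro a ⟨⟨haF, haB⟩, haA⟩
  exact hUa a ⟨haA, haF⟩ (hBU haB)

theorem exists_cantor_embedding :
    ∃ ι : (ℕ → Bool) → ℝ≥0∞, Topology.IsClosedEmbedding ι ∧ ∀ c, ι c ≠ ∞ := by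
  let j : (ℕ → Bool) → ℝ := fun c => (cantorSetHomeomorphNatToBool.symm c : ℝ)
  have hj : Continuous j := continuous_subtype_val.comp cantorSetHomeomorphNatToBool.symm.continuous
  have hj0 : ∀ c, 0 ≤ j c := fun c =>
    (cantorSet_subset_unitInterval (cantorSetHomeomorphNatToBool.symm c).2).1
  refine ⟨fun c => ENNReal.ofReal (j c), (ENNReal.continuous_ofReal.comp hj).isClosedEmbedding ?_,
    fun c => ENNReal.ofReal_ne_top⟩
  intro c c' h
  have h1 : j c = j c' := (ENNReal.ofReal_eq_ofReal_iff (hj0 c) (hj0 c')).1 h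
  exact cantorSetHomeomorphNatToBool.symm.injective (Subtype.ext h1)

open Filter Topology in
/-- Almost everywhere on `F`, the data `Dat`, restricted to points of `A` where `W` is almost
minimal, have a measurable cluster value. -/
theorem exists_limit_data [MetricSpace Y] [SecondCountableTopology Y] [BorelSpace Y]
    [SigmaFinite ν] (hA : HullFull ν F A) (hF : MeasurableSet F)
    (W : Y → ℝ≥0∞) (hW : ∀ a ∈ A, W a ≠ ∞) {T : Type*} [TopologicalSpace T] [CompactSpace T]
    [TopologicalSpace.MetrizableSpace T] [Nonempty T] [MeasurableSpace T] [BorelSpace T]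
    (Dat : Y → T) (f : Y → ℝ≥0∞) (hf : Measurable f) (hf0 : ∀ x, 0 < f x) :
    ∃ (φ : Y → ℝ≥0∞) (Φ : Y → T), Measurable φ ∧ Measurable Φ ∧ (∀ a ∈ A, φ a ≤ W a) ∧
      ∃ N : Set Y, ν N = 0 ∧ ∀ x ∈ F \ N, ∃ a : ℕ → Y, (∀ n, a n ∈ A ∩ F) ∧
        Tendsto a atTop (𝓝 x) ∧ Tendsto (fun n => Dat (a n)) atTop (𝓝 (Φ x)) ∧
        (∀ n, W (a n) ≤ φ (a n) + f (a n)) ∧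
        Tendsto (fun n => φ (a n) + f (a n)) atTop (𝓝 (φ x + f x)) := by
  obtain ⟨φ, hφ, hφW, hφA⟩ := exists_essInf hA W hW
  have hA' := hφA f hf hf0
  set A' := {a ∈ A | W a < φ a + f a} with hA'def
  obtain ⟨ι, hι, hιt⟩ := exists_cantor_embedding
  let _ : MetricSpace T := TopologicalSpace.metrizableSpaceMetric T
  obtain ⟨θ, hθ, hθs⟩ := exists_nat_bool_continuous_surjective_of_compact T
  obtain ⟨g, hg, hgι⟩ := hι.measurableEmbedding.exists_measurable_extend hθ.measurable
    (fun _ => inferInstance)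
  let ψ : Y → ℝ≥0∞ := fun x => ι (Function.surjInv hθs (Dat x))
  obtain ⟨ψ', hψ', hψ'le, hψ'A⟩ := exists_essInf hA' ψ (fun a _ => hιt _)
  let ε : ℕ → ℝ≥0∞ := fun n => (n + 1 : ℝ≥0∞)⁻¹
  have hε0 : ∀ n, 0 < ε n := fun n => by
    refine ENNReal.inv_pos.2 ?_
    finiteness
  have hε : Tendsto ε atTop (𝓝 0) := by
    have := (tendsto_add_atTop_iff_nat 1).2 ENNReal.tendsto_inv_nat_nhds_zero
    simpa [ε] using this
  let Θ : Y → Y × ℝ≥0∞ × ℝ≥0∞ := fun x => (x, φ x + f x, ψ' x)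
  have hΘ : Measurable Θ := measurable_id.prodMk ((hφ.add hf).prodMk hψ')
  let Bad : ℕ → Set Y := fun n => {x ∈ F | ¬ ∀ U ∈ nhds (Θ x),
    ∃ a ∈ {a ∈ A' | ψ a < ψ' a + ε n} ∩ F, Θ a ∈ U}
  refine ⟨φ, g ∘ ψ', hφ, hg.comp hψ', hφW, ⋃ n, Bad n, measure_iUnion_null fun n =>
    (hψ'A (fun _ => ε n) measurable_const (fun _ => hε0 n)).support hF hΘ, fun x hx => ?_⟩
  have hgood : ∀ n, ∀ U ∈ nhds (Θ x), ∃ a ∈ {a ∈ A' | ψ a < ψ' a + ε n} ∩ F, Θ a ∈ U := by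
    intro n
    by_contra hcon
    exact hx.2 (mem_iUnion.2 ⟨n, hx.1, hcon⟩)
  obtain ⟨U, hU⟩ := (nhds (Θ x)).exists_antitone_basis
  choose a haA haU using fun n => hgood n (U n) (hU.mem n)
  have hlim : Tendsto (fun n => Θ (a n)) atTop (𝓝 (Θ x)) := hU.tendsto haU
  have hlim1 : Tendsto a atTop (𝓝 x) := (continuous_fst.tendsto _).comp hlim
  have hlim2 : Tendsto (fun n => φ (a n) + f (a n)) atTop (𝓝 (φ x + f x)) :=
    ((continuous_fst.comp continuous_snd).tendsto _).comp hlim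
  have hlim3 : Tendsto (fun n => ψ' (a n)) atTop (𝓝 (ψ' x)) :=
    ((continuous_snd.comp continuous_snd).tendsto _).comp hlim
  have hψlim : Tendsto (fun n => ψ (a n)) atTop (𝓝 (ψ' x)) := by
    refine tendsto_of_tendsto_of_tendsto_of_le_of_le hlim3
      (by simpa using hlim3.add hε) (fun n => hψ'le _ (haA n).1.1) (fun n => (haA n).1.2.le)
  obtain ⟨c, hc⟩ : ψ' x ∈ range ι :=
    hι.isClosed_range.mem_of_tendsto hψlim (Eventually.of_forall fun n => mem_range_self _)
  refine ⟨a, fun n => ⟨(haA n).1.1.1, (haA n).2⟩, hlim1, ?_, fun n => (haA n).1.1.2.le, hlim2⟩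
  rw [← hc] at hψlim
  have h1 : Tendsto (fun n => Function.surjInv hθs (Dat (a n))) atTop (𝓝 c) :=
    hι.isEmbedding.tendsto_nhds_iff.2 hψlim
  have h2 := (hθ.tendsto c).comp h1
  have h3 : (g ∘ ψ') x = θ c := by
    rw [Function.comp_apply, ← hc]
    exact congrFun hgι c
  rw [h3]
  refine h2.congr fun n => ?_
  exact Function.surjInv_eq hθs _

end EssInf

section Closure

open Filter Topology

variable {Y : Type*} [MetricSpace Y] [SecondCountableTopology Y]

omit [SecondCountableTopology Y] in
theorem isLocallyFinite_trim {mY : MeasurableSpace Y} [OpensMeasurableSpace Y] {μ : Measure Y}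
    (h : ∀ (x : Y) (r : ℝ), μ (Metric.ball x r) < ∞) (hm : borel Y ≤ mY) :
    @IsLocallyFiniteMeasure Y (borel Y) _ (μ.trim hm) := by
  refine @IsLocallyFiniteMeasure.mk Y (borel Y) _ _ fun x => ⟨Metric.ball x 1,
    Metric.ball_mem_nhds x one_pos, ?_⟩
  rw [trim_measurableSet_eq hm]
  · exact h x 1
  · exact MeasurableSpace.measurableSet_generateFrom Metric.isOpen_ball

/-- Measure density passes to Borel subsets of the closure. -/
theorem measure_le_of_subset_closure {mY : MeasurableSpace Y} [OpensMeasurableSpace Y]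
    {μ : Measure Y} {D K : ℝ≥0∞} (hμ : IsMetricDoubling μ D) (hK : K ≠ ∞) {Ω : Set Y}
    (hden : ∀ x ∈ Ω, ∀ r : ℝ, 0 < r → r ≤ 1 →
      μ (Metric.ball x r) ≤ K * μ (Metric.ball x r ∩ Ω)) (hm : borel Y ≤ mY) {V : Set Y}
    (hVΩ : V ⊆ closure Ω) (hV : MeasurableSet[borel Y] V) :
    μ V ≤ D ^ 3 * K * μ (V ∩ Ω) := by
  have hopen : ∀ U : Set Y, IsOpen U → V ⊆ U → μ V ≤ D ^ 3 * K * μ (U ∩ Ω) := by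
    intro U hU hVU
    have hex : ∀ x : V, ∃ r : ℝ, ∃ p : Y, 0 < r ∧ r ≤ 1 ∧ p ∈ Ω ∧ dist (x : Y) p < r ∧
        Metric.ball p r ⊆ U := by
      intro x
      obtain ⟨ε, hε, hεU⟩ := Metric.isOpen_iff.1 hU x (hVU x.2)
      have hr : 0 < min 1 (ε / 2) := by positivity
      obtain ⟨p, hp, hxp⟩ := Metric.mem_closure_iff.1 (hVΩ x.2) _ hr
      refine ⟨min 1 (ε / 2), p, hr, min_le_left _ _, hp, hxp, fun y hy => hεU ?_⟩
      rw [Metric.mem_ball] at hy ⊢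
      have h1 := hy.trans_le (min_le_right _ _)
      have h2 := hxp.trans_le (min_le_right _ _)
      rw [dist_comm] at h2
      linarith [dist_triangle y p x]
    choose r p hr hr1 hp hxp hU' using hex
    refine le_trans (measure_mono fun x hx => ?_) (hμ.vitali (univ : Set V) p r 1
      (fun i _ => ⟨hr i, hr1 i⟩) 1 K (U ∩ Ω) fun i _ => ?_)
    · refine mem_iUnion₂.2 ⟨⟨x, hx⟩, mem_univ _, ?_⟩
      have := hxp ⟨x, hx⟩
      have h0 := hr ⟨x, hx⟩
      exact this.trans (by linarith)
    · rw [← inter_assoc, inter_eq_self_of_subset_left (hU' i)]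
      exact hden _ (hp i) _ (hr i) (hr1 i)
  let ν : @Measure Y (borel Y) := (μ.restrict Ω).trim hm
  have hν : ∀ V, MeasurableSet[borel Y] V → ν V = μ (V ∩ Ω) := fun V hV => by
    rw [trim_measurableSet_eq hm hV, Measure.restrict_apply (hm _ hV)]
  have hlf : @IsLocallyFiniteMeasure Y (borel Y) _ ν :=
    isLocallyFinite_trim (fun x r => (Measure.restrict_apply_le _ _).trans_lt (hμ.lt_top x r)) hm
  have hB : @BorelSpace Y _ (borel Y) := @BorelSpace.mk Y _ (borel Y) rfl
  have hout : @Measure.OuterRegular Y (borel Y) _ ν := inferInstance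
  rw [← hν V hV]
  have hc : D ^ 3 * K ≠ ∞ := ENNReal.mul_ne_top (ENNReal.pow_ne_top hμ.ne_top) hK
  refine ENNReal.le_of_forall_pos_le_add fun ε hε _ => ?_
  rcases eq_or_ne (ν V) ∞ with htop | htop
  · rcases eq_or_ne (D ^ 3 * K) 0 with h0 | h0
    · have := hopen univ isOpen_univ (subset_univ _)
      rw [h0, zero_mul] at this
      exact this.trans (zero_le)
    · rw [htop, ENNReal.mul_top h0, top_add]
      exact le_top
  · have hδ : (ε : ℝ≥0∞) / (D ^ 3 * K) ≠ 0 := by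
      simp [ENNReal.div_eq_zero_iff, hc, hε.ne']
    obtain ⟨U, hVU, hU, hlt⟩ := @Set.exists_isOpen_lt_of_lt Y (borel Y) ν _ hout V _
      (ENNReal.lt_add_right htop hδ)
    have hUm : MeasurableSet[borel Y] U := MeasurableSpace.measurableSet_generateFrom hU
    refine (hopen U hU hVU).trans ?_
    rw [← hν U hUm]
    refine (mul_le_mul_right hlt.le _).trans ?_
    rw [mul_add]
    gcongr
    exact ENNReal.mul_div_le

/-- The hull property of a subset of full measure in `Ω`. -/
theorem hullFull_closure {mY : MeasurableSpace Y} [OpensMeasurableSpace Y]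
    {μ : Measure Y} {D K : ℝ≥0∞} (hμ : IsMetricDoubling μ D) (hK : K ≠ ∞) {Ω : Set Y}
    (hden : ∀ x ∈ Ω, ∀ r : ℝ, 0 < r → r ≤ 1 →
      μ (Metric.ball x r) ≤ K * μ (Metric.ball x r ∩ Ω)) (hm : borel Y ≤ mY) {E : Set Y}
    (hE : μ E = 0) :
    @HullFull Y (borel Y) (μ.trim hm) (closure Ω) (Ω \ E) := by
  intro V hVΩ hV h0
  have h1 := measure_eq_zero_of_trim_eq_zero hm h0
  rw [trim_measurableSet_eq hm hV]
  have h2 := measure_le_of_subset_closure hμ hK hden hm hVΩ hV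
  have h3 : μ (V ∩ Ω) = 0 := by
    refine measure_mono_null (t := (V ∩ (Ω \ E)) ∪ E) (fun x hx => ?_) (measure_union_null h1 hE)
    by_cases hxE : x ∈ E
    · exact Or.inr hxE
    · exact Or.inl ⟨hx.1, hx.2, hxE⟩
  rw [h3, mul_zero] at h2
  exact le_antisymm h2 (zero_le)

theorem lintegral_closure_le {mY : MeasurableSpace Y} [OpensMeasurableSpace Y]
    {μ : Measure Y} {D K : ℝ≥0∞} (hμ : IsMetricDoubling μ D) (hK : K ≠ ∞) {Ω : Set Y}
    (hden : ∀ x ∈ Ω, ∀ r : ℝ, 0 < r → r ≤ 1 →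
      μ (Metric.ball x r) ≤ K * μ (Metric.ball x r ∩ Ω)) (hm : borel Y ≤ mY) {φ : Y → ℝ≥0∞}
    (hφ : Measurable[borel Y] φ) :
    ∫⁻ x in closure Ω, φ x ∂μ ≤ D ^ 3 * K * ∫⁻ x in Ω, φ x ∂μ := by
  rw [← lintegral_trim hm hφ, ← lintegral_trim hm hφ, ← smul_eq_mul, ← @lintegral_smul_measure]
  refine @lintegral_mono' Y (borel Y) _ _ ?_ _ _ le_rfl
  refine @Measure.le_iff Y (borel Y) _ _ |>.2 fun V hV => ?_
  rw [trim_measurableSet_eq hm hV, Measure.restrict_apply (hm _ hV)]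
  have hcl : MeasurableSet[borel Y] (closure Ω) :=
    @MeasurableSet.of_compl Y _ (borel Y)
      (MeasurableSpace.measurableSet_generateFrom isClosed_closure.isOpen_compl)
  have h2 := measure_le_of_subset_closure hμ hK hden hm (V := V ∩ closure Ω) inter_subset_right
    (@MeasurableSet.inter Y (borel Y) _ _ hV hcl)
  refine h2.trans ?_
  rw [@Measure.smul_apply, smul_eq_mul, trim_measurableSet_eq hm hV,
    Measure.restrict_apply (hm _ hV)]
  gcongr
  exact inter_subset_left

theorem lqN_le_of_tendsto {q : ℝ≥0∞} (hq : 0 < q) {a : ℕ → ℤ → ℝ≥0∞} {c : ℤ → ℝ≥0∞}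
    {R : ℕ → ℝ≥0∞} {R' : ℝ≥0∞} (ha : ∀ k, Tendsto (fun n => a n k) atTop (𝓝 (c k)))
    (hR : Tendsto R atTop (𝓝 R')) (h : ∀ n, lqN q (a n) ≤ R n) : lqN q c ≤ R' := by
  unfold lqN at h ⊢
  split_ifs at h ⊢ with hq'
  · exact iSup_le fun k => le_of_tendsto_of_tendsto' (ha k) hR fun n => (le_iSup _ k).trans (h n)
  · have hq0 : 0 < q.toReal := ENNReal.toReal_pos hq.ne' hq'
    rw [one_div, ENNReal.rpow_inv_le_iff hq0, ENNReal.tsum_eq_iSup_sum]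
    refine iSup_le fun s => le_of_tendsto_of_tendsto'
      (tendsto_finsetSum s fun k _ => (ha k).ennrpow_const _) (hR.ennrpow_const _) fun n => ?_
    have := h n
    rw [one_div, ENNReal.rpow_inv_le_iff hq0] at this
    exact (ENNReal.sum_le_tsum s).trans this

end Closure

section ClosureExtension

open Filter Topology

/-- The multiscale Hajłasz inequality for `u` on `S`: any two points are compared at some scale
`k` with `b ^ (-k)` comparable to their distance. -/
def MultiscaleBound {Y : Type*} [MetricSpace Y] (b β L : ℝ) (S : Set Y) (u : Y → ℝ)
    (g : ℤ → Y → ℝ≥0∞) : Prop :=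
  ∀ x ∈ S, ∀ y ∈ S, x ≠ y → ∃ k : ℤ, b ^ (-k) ≤ L * dist x y ∧ dist x y ≤ L * b ^ (-k) ∧
    edist (u x) (u y) ≤ ENNReal.ofReal (β ^ (-k)) * (g k x + g k y)

theorem finite_zpow_window {b : ℝ} (hb : 1 < b) {A B : ℝ} (hA : 0 < A) :
    {k : ℤ | A ≤ b ^ (-k) ∧ b ^ (-k) ≤ B}.Finite := by
  rcases le_or_gt B 0 with hB | hB
  · refine Set.Finite.subset Set.finite_empty fun k hk => ?_
    linarith [hk.1, hk.2]
  obtain ⟨n, hn, -⟩ := exists_mem_Ico_zpow hA hb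
  obtain ⟨m, -, hm⟩ := exists_mem_Ico_zpow hB hb
  refine (Set.finite_Icc (-(m + 1)) (-n)).subset fun k hk => ?_
  have h1 := (zpow_le_zpow_iff_right₀ hb).1 (hn.trans hk.1)
  have h2 := (zpow_lt_zpow_iff_right₀ hb).1 (hk.2.trans_lt hm)
  constructor <;> omega

variable {Y : Type*} [MetricSpace Y]

theorem MultiscaleBound.of_tendsto {b β L : ℝ} (hb : 1 < b) (hL : 1 ≤ L) {S S' : Set Y}
    {u v : Y → ℝ} {g g' : ℤ → Y → ℝ≥0∞} (h : MultiscaleBound b β L S u g)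
    (hS : ∀ x ∈ S', ∃ a : ℕ → Y, (∀ n, a n ∈ S) ∧ Tendsto a atTop (𝓝 x) ∧
      Tendsto (fun n => u (a n)) atTop (𝓝 (v x)) ∧
      ∀ k, Tendsto (fun n => g k (a n)) atTop (𝓝 (g' k x))) :
    MultiscaleBound b β (2 * L) S' v g' := by
  intro x hx y hy hxy
  obtain ⟨a, haS, ha, hau, hag⟩ := hS x hx
  obtain ⟨c, hcS, hc, hcu, hcg⟩ := hS y hy
  have hd : 0 < dist x y := dist_pos.2 hxy
  have hL0 : 0 < L := by linarith
  have hdist : Tendsto (fun n => dist (a n) (c n)) atTop (𝓝 (dist x y)) := ha.dist hc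
  have hev : ∀ᶠ n in atTop, ∃ k ∈ {k : ℤ | dist x y / (2 * L) ≤ b ^ (-k) ∧
      b ^ (-k) ≤ 2 * L * dist x y}, edist (u (a n)) (u (c n)) ≤
        ENNReal.ofReal (β ^ (-k)) * (g k (a n) + g k (c n)) := by
    filter_upwards [hdist.eventually (lt_mem_nhds (show dist x y / 2 < dist x y by linarith)),
      hdist.eventually (gt_mem_nhds (show dist x y < 2 * dist x y by linarith))] with n h1 h2
    have hne : a n ≠ c n := dist_pos.1 (by linarith)
    obtain ⟨k, hk1, hk2, hk3⟩ := h _ (haS n) _ (hcS n) hne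
    refine ⟨k, ⟨?_, ?_⟩, hk3⟩
    · rw [div_le_iff₀ (by positivity)]
      linarith
    · exact hk1.trans (by nlinarith)
  have hfin := finite_zpow_window hb (A := dist x y / (2 * L)) (B := 2 * L * dist x y)
    (by positivity)
  have hfreq : ∃ k ∈ {k : ℤ | dist x y / (2 * L) ≤ b ^ (-k) ∧ b ^ (-k) ≤ 2 * L * dist x y},
      ∃ᶠ n in atTop, edist (u (a n)) (u (c n)) ≤
        ENNReal.ofReal (β ^ (-k)) * (g k (a n) + g k (c n)) := by
    by_contra! hcon
    have h2 := (eventually_all_finite hfin).2 hcon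
    obtain ⟨n, ⟨k, hk, hk1⟩, hn⟩ := (hev.and h2).exists
    exact (hn k hk).not_ge hk1
  obtain ⟨k, ⟨hk1, hk2⟩, hk⟩ := hfreq
  refine ⟨k, hk2, ?_, ?_⟩
  · rw [div_le_iff₀ (by positivity)] at hk1
    linarith
  · exact le_of_tendsto_of_tendsto_of_frequently (hau.edist hcu)
      (ENNReal.Tendsto.const_mul ((hag k).add (hcg k)) (Or.inr ofReal_ne_top)) hk

theorem lpow_add_le {p : ℝ} (hp : 0 ≤ p) (a c : ℝ≥0∞) :
    (a + c) ^ p ≤ 2 ^ p * (a ^ p + c ^ p) := by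
  calc (a + c) ^ p ≤ (2 * max a c) ^ p := by
        gcongr
        rw [two_mul]
        exact add_le_add (le_max_left _ _) (le_max_right _ _)
    _ = 2 ^ p * (max a c) ^ p := ENNReal.mul_rpow_of_nonneg _ _ hp
    _ ≤ 2 ^ p * (a ^ p + c ^ p) := by
        gcongr
        rcases le_total a c with h | h
        · rw [max_eq_right h]; exact le_add_self
        · rw [max_eq_left h]; exact le_self_add

/-- Extension from a set with the measure density condition to its closure. -/
theorem exists_closure_extension [SecondCountableTopology Y] {mY : MeasurableSpace Y}
    [OpensMeasurableSpace Y] {μ : Measure Y} {D K : ℝ≥0∞} (hμ : IsMetricDoubling μ D)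
    (hK : K ≠ ∞) {Ω : Set Y} (hΩ : MeasurableSet Ω)
    (hden : ∀ x ∈ Ω, ∀ r : ℝ, 0 < r → r ≤ 1 →
      μ (Metric.ball x r) ≤ K * μ (Metric.ball x r ∩ Ω))
    {b β L p : ℝ} {q : ℝ≥0∞} (hb : 1 < b) (hL : 1 ≤ L) (hp : 0 < p) (hq : 0 < q)
    {u : Y → ℝ} {g : ℤ → Y → ℝ≥0∞} (hu : Measurable u) (hg : ∀ k, Measurable (g k)) {E : Set Y}
    (hE : μ E = 0) (hmb : MultiscaleBound b β L (Ω \ E) u g)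
    (hu0 : ∀ x ∈ Ω \ E, ENNReal.ofReal |u x| ≤ g 0 x)
    (hW : ∀ x ∈ Ω \ E, lqN q (fun k => g k x) ≠ ∞)
    (hWint : ∫⁻ x in Ω, lqN q (fun k => g k x) ^ p ∂μ ≠ ∞) {δ : ℝ≥0∞} (hδ : δ ≠ 0)
    (hδt : δ ≠ ∞) :
    ∃ (v : Y → ℝ) (g' : ℤ → Y → ℝ≥0∞) (R : Y → ℝ≥0∞) (E' : Set Y),
      Measurable v ∧ (∀ k, Measurable (g' k)) ∧ Measurable R ∧ μ E' = 0 ∧ (∀ x ∈ Ω, v x = u x) ∧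
      MultiscaleBound b β (2 * L) (closure Ω \ E') v g' ∧
      (∀ x ∈ closure Ω \ E', ENNReal.ofReal |v x| ≤ g' 0 x) ∧
      (∀ x ∈ closure Ω \ E', lqN q (fun k => g' k x) ≤ R x) ∧
      ∫⁻ x in closure Ω, R x ^ p ∂μ ≤ (1 + 2 ^ p * (D ^ 3 * K + 1)) *
        (∫⁻ x in Ω, lqN q (fun k => g k x) ^ p ∂μ + δ) := by
  classical
  have hm : borel Y ≤ mY := OpensMeasurableSpace.borel_le
  set F := closure Ω with hF
  set W : Y → ℝ≥0∞ := fun x => lqN q fun k => g k x with hWdef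
  have hWm : Measurable W := measurable_lqN q hg
  have hull := hullFull_closure hμ hK hden hm hE
  have hB : @BorelSpace Y _ (borel Y) := @BorelSpace.mk Y _ (borel Y) rfl
  have hlf := isLocallyFinite_trim hμ.lt_top hm
  have hsf : @SigmaFinite Y (borel Y) (μ.trim hm) := inferInstance
  have hFm : MeasurableSet[borel Y] F := @MeasurableSet.of_compl Y _ (borel Y)
      (MeasurableSpace.measurableSet_generateFrom isClosed_closure.isOpen_compl)
  obtain ⟨g₀, hg₀pos, hg₀m, hg₀⟩ := @exists_pos_lintegral_lt_of_sigmaFinite Y (borel Y)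
    (μ.trim hm) hsf δ hδ
  let f : Y → ℝ≥0∞ := fun x => (g₀ x : ℝ≥0∞) ^ (1 / p)
  have hf : Measurable[borel Y] f :=
    ENNReal.continuous_rpow_const.measurable.comp hg₀m.coe_nnreal_ennreal
  have hf0 : ∀ x, 0 < f x := fun x =>
    ENNReal.rpow_pos (ENNReal.coe_pos.2 (hg₀pos x)) ENNReal.coe_ne_top
  let Dat : Y → (ℤ → ℝ≥0∞) × ℝ≥0∞ × ℝ≥0∞ := fun a =>
    (fun k => g k a, ENNReal.ofReal (u a), ENNReal.ofReal (-u a))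
  obtain ⟨φ, Φ, hφ, hΦ, hφW, N, hN, hlim⟩ := @exists_limit_data Y (borel Y) (μ.trim hm) F (Ω \ E)
    _ _ hB hsf hull hFm W hW _ _ _ _ _ _ _ Dat f hf hf0
  have hφ' : Measurable φ := hφ.mono hm le_rfl
  have hf' : Measurable f := hf.mono hm le_rfl
  have hΦ' : Measurable Φ := hΦ.mono hm le_rfl
  have hN' : μ N = 0 := measure_eq_zero_of_trim_eq_zero hm hN
  have hR : Measurable (Ω.piecewise W fun x => φ x + f x) := hWm.piecewise hΩ (hφ'.add hf')
  have hΩF : Ω ⊆ F := subset_closure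
  have hFm' : MeasurableSet F := hm _ hFm
  have hfint : ∫⁻ x in F, f x ^ p ∂μ ≤ δ := by
    refine (setLIntegral_le_lintegral _ _).trans ?_
    rw [lintegral_trim hm hg₀m.coe_nnreal_ennreal] at hg₀
    refine (lintegral_mono fun x => ?_).trans hg₀.le
    simp only [f]
    rw [← ENNReal.rpow_mul, one_div_mul_cancel hp.ne', ENNReal.rpow_one]
  have hφint : ∫⁻ x in F, φ x ^ p ∂μ ≤ D ^ 3 * K * ∫⁻ x in Ω, W x ^ p ∂μ := by
    refine (lintegral_closure_le hμ hK hden hm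
      (ENNReal.continuous_rpow_const.measurable.comp hφ)).trans ?_
    gcongr 1
    refine lintegral_mono_ae ?_
    rw [ae_restrict_iff' hΩ]
    filter_upwards [compl_mem_ae_iff.2 hE] with x hx hxΩ
    simp only [Function.comp]
    gcongr
    exact hφW x ⟨hxΩ, hx⟩
  have hRint : ∫⁻ x in F, (Ω.piecewise W fun x => φ x + f x) x ^ p ∂μ ≤
      (1 + 2 ^ p * (D ^ 3 * K + 1)) * (∫⁻ x in Ω, W x ^ p ∂μ + δ) := by
    have hle : ∀ x, (Ω.piecewise W fun x => φ x + f x) x ^ p ≤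
        Ω.indicator (fun x => W x ^ p) x + 2 ^ p * (φ x ^ p + f x ^ p) := fun x => by
      by_cases hx : x ∈ Ω
      · rw [piecewise_eq_of_mem _ _ _ hx, indicator_of_mem hx]
        exact le_self_add
      · rw [piecewise_eq_of_notMem _ _ _ hx]
        exact (lpow_add_le hp.le _ _).trans le_add_self
    calc _ ≤ ∫⁻ x in F, (Ω.indicator (fun x => W x ^ p) x + 2 ^ p * (φ x ^ p + f x ^ p)) ∂μ :=
          lintegral_mono hle
      _ = ∫⁻ x in F, Ω.indicator (fun x => W x ^ p) x ∂μ +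
          2 ^ p * (∫⁻ x in F, φ x ^ p ∂μ + ∫⁻ x in F, f x ^ p ∂μ) := by
        rw [lintegral_add_left ((hWm.pow_const p).indicator hΩ),
          lintegral_const_mul _ (by fun_prop),
          lintegral_add_left (hφ'.pow_const p)]
      _ ≤ ∫⁻ x in Ω, W x ^ p ∂μ + 2 ^ p * (D ^ 3 * K * ∫⁻ x in Ω, W x ^ p ∂μ + δ) := by
        refine add_le_add ?_ (mul_le_mul_right (add_le_add hφint hfint) _)
        rw [← lintegral_indicator hΩ]
        exact setLIntegral_le_lintegral _ _
      _ ≤ _ := by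
        rw [add_mul, one_mul, mul_assoc ((2 : ℝ≥0∞) ^ p) (D ^ 3 * K + 1)]
        refine add_le_add le_self_add (mul_le_mul_right ?_ _)
        rw [add_mul, one_mul]
        exact add_le_add (mul_le_mul_right le_self_add _) le_add_self
  have hRtop : ∫⁻ x in F, (Ω.piecewise W fun x => φ x + f x) x ^ p ∂μ ≠ ∞ := by
    refine ne_top_of_le_ne_top (ENNReal.mul_ne_top ?_ (ENNReal.add_ne_top.2 ⟨hWint, hδt⟩)) hRint
    have : D ^ 3 * K ≠ ∞ := ENNReal.mul_ne_top (ENNReal.pow_ne_top hμ.ne_top) hK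
    have h2 : (2 : ℝ≥0∞) ^ p ≠ ∞ := ENNReal.rpow_ne_top_of_nonneg hp.le (by simp)
    simp [ENNReal.mul_eq_top, this, h2]
  set R := Ω.piecewise W fun x => φ x + f x with hRdef
  have hNR : μ {x ∈ F | R x = ∞} = 0 := by
    have := ae_lt_top (hR.pow_const p) hRtop
    rw [ae_restrict_iff' hFm'] at this
    refine measure_mono_null (fun x hx => ?_) (ae_iff.1 this)
    simp [hx.1, hx.2, hp]
  let v : Y → ℝ := Ω.piecewise u fun x => (Φ x).2.1.toReal - (Φ x).2.2.toReal
  let g' : ℤ → Y → ℝ≥0∞ := fun k => Ω.piecewise (g k) fun x => (Φ x).1 k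
  let E' : Set Y := E ∪ N ∪ {x ∈ F | R x = ∞}
  have key : ∀ x ∈ F \ E', ∃ a : ℕ → Y, (∀ n, a n ∈ Ω \ E) ∧ Tendsto a atTop (𝓝 x) ∧
      Tendsto (fun n => u (a n)) atTop (𝓝 (v x)) ∧
      (∀ k, Tendsto (fun n => g k (a n)) atTop (𝓝 (g' k x))) ∧
      ∃ r : ℕ → ℝ≥0∞, (∀ n, W (a n) ≤ r n) ∧ Tendsto r atTop (𝓝 (R x)) := by
    rintro x ⟨hxF, hxE'⟩
    have hxE : x ∉ E := fun h => hxE' (Or.inl (Or.inl h))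
    have hxN : x ∉ N := fun h => hxE' (Or.inl (Or.inr h))
    have hxR : R x ≠ ∞ := fun h => hxE' (Or.inr ⟨hxF, h⟩)
    by_cases hx : x ∈ Ω
    · refine ⟨fun _ => x, fun _ => ⟨hx, hxE⟩, tendsto_const_nhds, ?_, fun k => ?_, fun _ => W x,
        fun _ => le_rfl, ?_⟩
      · simp [v, hx]
      · simp [g', hx]
      · simp [hRdef, hx]
    · obtain ⟨a, haA, ha, haD, haW, haR⟩ := hlim x ⟨hxF, hxN⟩
      have hRx : R x = φ x + f x := by simp [hRdef, hx]
      have h1 := (continuous_fst.tendsto _).comp haD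
      have h2 := ((continuous_fst.comp continuous_snd).tendsto _).comp haD
      have h3 := ((continuous_snd.comp continuous_snd).tendsto _).comp haD
      have habs : ∀ n, ENNReal.ofReal |u (a n)| ≤ φ (a n) + f (a n) := fun n =>
        (hu0 _ (haA n).1).trans ((le_lqN hq (fun k => g k (a n)) 0).trans (haW n))
      have h2t : (Φ x).2.1 ≠ ∞ := ne_top_of_le_ne_top (hRx ▸ hxR)
        (le_of_tendsto_of_tendsto' h2 haR fun n =>
          (ENNReal.ofReal_le_ofReal (le_abs_self _)).trans (habs n))
      have h3t : (Φ x).2.2 ≠ ∞ := ne_top_of_le_ne_top (hRx ▸ hxR)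
        (le_of_tendsto_of_tendsto' h3 haR fun n =>
          (ENNReal.ofReal_le_ofReal (neg_le_abs _)).trans (habs n))
      refine ⟨a, fun n => (haA n).1, ha, ?_, fun k => ?_, fun n => φ (a n) + f (a n), haW, ?_⟩
      · have h4 := ((ENNReal.tendsto_toReal h2t).comp h2).sub ((ENNReal.tendsto_toReal h3t).comp h3)
        have hv : v x = (Φ x).2.1.toReal - (Φ x).2.2.toReal := by simp [v, hx]
        rw [hv]
        refine h4.congr fun n => ?_
        simp only [Function.comp, Dat, ENNReal.toReal_ofReal']
        exact max_zero_sub_max_neg_zero_eq_self _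
      · have hg'x : g' k x = (Φ x).1 k := by simp [g', hx]
        rw [hg'x]
        exact (tendsto_pi_nhds.1 h1) k
      · rw [hRx]
        exact haR
  refine ⟨v, g', R, E', ?_, fun k => ?_, hR, ?_, fun x hx => ?_, ?_, ?_, ?_, hRint⟩
  · exact hu.piecewise hΩ (hΦ'.snd.fst.ennreal_toReal.sub hΦ'.snd.snd.ennreal_toReal)
  · exact (hg k).piecewise hΩ ((measurable_pi_apply k).comp hΦ'.fst)
  · exact measure_union_null (measure_union_null hE hN') hNR
  · simp [v, hx]
  · refine hmb.of_tendsto hb hL fun x hx => ?_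
    obtain ⟨a, h1, h2, h3, h4, -⟩ := key x hx
    exact ⟨a, h1, h2, h3, h4⟩
  · intro x hx
    obtain ⟨a, h1, h2, h3, h4, -⟩ := key x hx
    exact le_of_tendsto_of_tendsto' (ENNReal.tendsto_ofReal h3.abs) (h4 0) fun n => hu0 _ (h1 n)
  · intro x hx
    obtain ⟨a, h1, h2, h3, h4, r, hr, hr'⟩ := key x hx
    exact lqN_le_of_tendsto hq h4 hr' hr

end ClosureExtension

section Whitney

open Metric

variable {Y : Type*} [MetricSpace Y]

theorem MultiscaleBound.edist_le {b β L : ℝ} (hb : 0 < b) (hL : 1 ≤ L) {S : Set Y} {u : Y → ℝ}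
    {g : ℤ → Y → ℝ≥0∞} (h : MultiscaleBound b β L S u g) {x y : Y} (hx : x ∈ S) (hy : y ∈ S)
    {t : ℝ} (ht : dist x y ≤ t) :
    edist (u x) (u y) ≤ ENNReal.ofReal L *
      (modu b β (fun k => g k x) t + modu b β (fun k => g k y) t) := by
  rcases eq_or_ne x y with rfl | hxy
  · simp
  obtain ⟨k, hk1, -, hk3⟩ := h x hx y hy hxy
  have hk : b ^ (-k) ≤ L * t := hk1.trans (by gcongr)
  refine hk3.trans ?_
  rw [mul_add, mul_add]
  exact add_le_add (term_le_modu hb (fun k => g k x) hL k hk)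
    (term_le_modu hb (fun k => g k y) hL k hk)

/-- If `z` is close to `x` relative to its distance to `F`, then `x` and `z` have comparable
distances to `F`. -/
theorem infDist_comparable {F : Set Y} {x z : Y} (h : dist x z < infDist z F / 4) :
    4 * infDist x F ≤ 5 * infDist z F ∧ 3 * infDist z F ≤ 4 * infDist x F := by
  have h1 := infDist_le_infDist_add_dist (s := F) (x := x) (y := z)
  have h2 := infDist_le_infDist_add_dist (s := F) (x := z) (y := x)
  rw [dist_comm z x] at h2
  constructor <;> linarith

variable [MeasurableSpace Y] {μ : Measure Y} {D : ℝ≥0∞}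

theorem card_whitney_le [OpensMeasurableSpace Y] (hμ : IsMetricDoubling μ D) {F : Set Y} {x : Y}
    (A : Finset Y) (hdisj : (A : Set Y).PairwiseDisjoint fun z => ball z (infDist z F / 40))
    (hA : ∀ z ∈ A, 0 < infDist z F ∧ dist x z < infDist z F / 4) : (A.card : ℝ≥0∞) ≤ D ^ 7 := by
  rcases A.eq_empty_or_nonempty with rfl | ⟨z₀, hz₀⟩
  · simp
  set r := infDist x F with hr
  have hr0 : 0 < r := by
    have := (infDist_comparable (hA z₀ hz₀).2).2
    linarith [(hA z₀ hz₀).1]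
  have hball : ∀ z ∈ A, μ (ball x r) ≤ D ^ 7 * μ (ball z (r / 50)) := fun z hz => by
    refine (measure_mono (ball_subset_ball' ?_)).trans (hμ.ball_pow z (by positivity) 7)
    have := (infDist_comparable (hA z hz).2).2
    linarith [(hA z hz).2]
  have hsub : (⋃ z ∈ A, ball z (r / 50)) ⊆ ball x r := by
    refine iUnion₂_subset fun z hz => ball_subset_ball' ?_
    have := (infDist_comparable (hA z hz).2).2
    rw [dist_comm]
    linarith [(hA z hz).2]
  have hd : (A : Set Y).PairwiseDisjoint fun z => ball z (r / 50) :=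
    hdisj.mono_on fun z hz => ball_subset_ball (by
      have := (infDist_comparable (hA z hz).2).1
      linarith)
  have hm := measure_biUnion_finset (μ := μ) hd (fun z _ => measurableSet_ball)
  have h0 : μ (ball x r) ≠ 0 := (hμ.pos x r hr0).ne'
  have ht : μ (ball x r) ≠ ∞ := (hμ.lt_top x r).ne
  have : (A.card : ℝ≥0∞) * μ (ball x r) ≤ D ^ 7 * μ (ball x r) := by
    calc (A.card : ℝ≥0∞) * μ (ball x r) = ∑ z ∈ A, μ (ball x r) := by simp
      _ ≤ ∑ z ∈ A, D ^ 7 * μ (ball z (r / 50)) := Finset.sum_le_sum hball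
      _ = D ^ 7 * μ (⋃ z ∈ A, ball z (r / 50)) := by rw [hm, Finset.mul_sum]
      _ ≤ _ := by gcongr
  exact (ENNReal.mul_le_mul_iff_left h0 ht).1 this

/-- A Whitney-type family of centers for the points at distance less than `2` from `F`. -/
theorem exists_whitney [SecondCountableTopology Y] [OpensMeasurableSpace Y]
    (hμ : IsMetricDoubling μ D) (F : Set Y) {N : ℕ} (hN : D ^ 7 ≤ N) :
    ∃ Z : Set Y, Z.Countable ∧ (∀ z ∈ Z, 0 < infDist z F ∧ infDist z F < 2) ∧
      (∀ x, 0 < infDist x F → infDist x F < 2 → ∃ z ∈ Z, dist x z < infDist z F / 10) ∧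
      ∃ act : Y → Finset Y, (∀ x, (act x).card ≤ N) ∧
        ∀ x z, z ∈ act x ↔ z ∈ Z ∧ dist x z < infDist z F / 4 := by
  obtain ⟨Z, hZT, hdisj, hcov⟩ := Vitali.exists_disjoint_subfamily_covering_enlargement_ball
    {z : Y | 0 < infDist z F ∧ infDist z F < 2} id (fun z => infDist z F / 40) 1
    (fun z hz => by linarith [hz.2]) 4 (by norm_num)
  simp only [id] at hdisj hcov
  have hfin : ∀ x, {z ∈ Z | dist x z < infDist z F / 4}.Finite ∧
      {z ∈ Z | dist x z < infDist z F / 4}.ncard ≤ N := fun x => by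
    have hcard : ∀ A : Finset Y, (A : Set Y) ⊆ {z ∈ Z | dist x z < infDist z F / 4} →
        A.card ≤ N := fun A hA => by
      have := (card_whitney_le hμ (x := x) A (hdisj.subset fun z hz => (hA hz).1)
        fun z hz => ⟨(hZT (hA hz).1).1, (hA hz).2⟩).trans hN
      exact_mod_cast this
    have hf : {z ∈ Z | dist x z < infDist z F / 4}.Finite := by
      by_contra hinf
      obtain ⟨A, hA, hAc⟩ := Set.Infinite.exists_subset_card_eq hinf (N + 1)
      have := hcard A hA
      omega
    refine ⟨hf, ?_⟩
    rw [Set.ncard_eq_toFinset_card _ hf]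
    exact hcard _ (by simp)
  refine ⟨Z, hdisj.countable_of_isOpen (fun _ _ => isOpen_ball) fun z hz =>
    nonempty_ball.2 (by have := (hZT hz).1; positivity), hZT, fun x hx0 hx2 => ?_,
    fun x => (hfin x).1.toFinset, fun x => ?_, fun x z => by simp⟩
  · obtain ⟨z, hz, hxz⟩ := hcov x ⟨hx0, hx2⟩
    refine ⟨z, hz, ?_⟩
    have : dist x z < 4 * (infDist z F / 40) := hxz (mem_ball_self (by positivity))
    linarith
  · rw [← Set.ncard_eq_toFinset_card _ (hfin x).1]
    exact (hfin x).2

omit [MetricSpace Y] in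
/-- A point of a set where a function does not exceed its median. -/
theorem exists_le_median {S E : Set Y} (hS0 : μ S ≠ 0) (hSt : μ S ≠ ∞) (hE : μ E = 0)
    (W : Y → ℝ≥0∞) :
    ∃ a ∈ S \ E, ∀ c < W a, μ S ≤ 2 * μ (S ∩ {x | c < W x}) := by
  set m : ℝ≥0∞ := sSup {c | μ S ≤ 2 * μ (S ∩ {x | c < W x})} with hm
  have hupper : 2 * μ (S ∩ {x | m < W x}) ≤ μ S := by
    rcases eq_or_ne m ∞ with h | h
    · simp [h]
    · obtain ⟨c, hc, hcm, hct⟩ := exists_seq_strictAnti_tendsto' (lt_top_iff_ne_top.2 h)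
      have hun : S ∩ {x | m < W x} = ⋃ n, S ∩ {x | c n < W x} := by
        ext x
        simp only [mem_inter_iff, mem_ofPred_eq, mem_iUnion]
        constructor
        · rintro ⟨h1, h2⟩
          obtain ⟨n, hn⟩ := (hct.eventually (gt_mem_nhds h2)).exists
          exact ⟨n, h1, hn⟩
        · rintro ⟨n, h1, h2⟩
          exact ⟨h1, (hcm n).1.trans h2⟩
      have hmono : Monotone fun n => S ∩ {x | c n < W x} := fun i j hij x hx =>
        ⟨hx.1, (hc.antitone hij).trans_lt hx.2⟩
      rw [hun, hmono.measure_iUnion, ENNReal.mul_iSup]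
      refine iSup_le fun n => ?_
      by_contra hcon
      exact absurd (le_sSup (a := c n) (s := {c | μ S ≤ 2 * μ (S ∩ {x | c < W x})})
        (not_le.1 hcon).le) (hcm n).1.not_ge
  have hpos : μ (S ∩ {x | W x ≤ m}) ≠ 0 := by
    intro h0
    have h1 : μ S ≤ μ (S ∩ {x | m < W x}) + μ (S ∩ {x | W x ≤ m}) := by
      refine (measure_mono fun x hx => ?_).trans (measure_union_le _ _)
      rcases lt_or_ge m (W x) with h | h
      · exact Or.inl ⟨hx, h⟩
      · exact Or.inr ⟨hx, h⟩
    rw [h0, add_zero] at h1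
    have h2 : 2 * μ S ≤ 1 * μ S := by rw [one_mul]; exact (mul_le_mul_right h1 _).trans hupper
    have := (ENNReal.mul_le_mul_iff_left hS0 hSt).1 h2
    norm_num at this
  have hne : μ ((S ∩ {x | W x ≤ m}) \ E) ≠ 0 := by rwa [measure_sdiff_null hE]
  obtain ⟨a, ⟨haS, ham⟩, haE⟩ := nonempty_of_measure_ne_zero hne
  refine ⟨a, ⟨haS, haE⟩, fun c hc => ?_⟩
  obtain ⟨c', hc', hcc'⟩ := lt_sSup_iff.1 (hc.trans_le ham)
  exact hc'.trans (mul_le_mul_right (measure_mono (t := S ∩ {x | c < W x}) fun x hx =>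
    ⟨hx.1, hcc'.trans hx.2⟩) _)

omit [MetricSpace Y] in
theorem lintegral_eq_lintegral_measure_lt [SFinite μ] {f : Y → ℝ≥0∞} (hf : Measurable f) :
    ∫⁻ x, f x ∂μ = ∫⁻ t in Ioi (0 : ℝ), μ {x | ENNReal.ofReal t < f x} := by
  have hval : ∀ c : ℝ≥0∞, volume (Ioi (0 : ℝ) ∩ {t | ENNReal.ofReal t < c}) = c := fun c => by
    rcases eq_or_ne c ∞ with rfl | hc
    · simp
    · have : Ioi (0 : ℝ) ∩ {t | ENNReal.ofReal t < c} = Ioo 0 c.toReal := by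
        ext t
        simp only [mem_inter_iff, mem_Ioi, mem_ofPred_eq, mem_Ioo]
        refine and_congr_right fun ht => ?_
        rw [ENNReal.ofReal_lt_iff_lt_toReal ht.le hc]
      rw [this, Real.volume_Ioo, sub_zero, ENNReal.ofReal_toReal hc]
  have hms : MeasurableSet {z : Y × ℝ | ENNReal.ofReal z.2 < f z.1} :=
    measurableSet_lt (ENNReal.measurable_ofReal.comp measurable_snd) (hf.comp measurable_fst)
  calc ∫⁻ x, f x ∂μ
      = ∫⁻ x, (volume.restrict (Ioi (0 : ℝ))) {t | ENNReal.ofReal t < f x} ∂μ := by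
        refine lintegral_congr fun x => ?_
        rw [Measure.restrict_apply (measurableSet_lt ENNReal.measurable_ofReal measurable_const),
          inter_comm, hval]
    _ = (μ.prod (volume.restrict (Ioi (0 : ℝ)))) {z : Y × ℝ | ENNReal.ofReal z.2 < f z.1} :=
        (Measure.prod_apply hms).symm
    _ = _ := Measure.prod_apply_symm hms

omit [MetricSpace Y] in
theorem lintegral_rpow_le_of_measure_lt_le [SFinite μ] {A : Set Y} {f h : Y → ℝ≥0∞} (hf : Measurable f)
    (hh : Measurable h) {c : ℝ≥0∞} (hfh : ∀ l, μ {x | l < f x} ≤ c * μ (A ∩ {x | l < h x}))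
    {p : ℝ} (hp : 0 < p) : ∫⁻ x, f x ^ p ∂μ ≤ c * ∫⁻ x in A, h x ^ p ∂μ := by
  rw [lintegral_eq_lintegral_measure_lt (hf.pow_const p),
    lintegral_eq_lintegral_measure_lt (hh.pow_const p)]
  have hanti : Antitone fun t : ℝ => (μ.restrict A) {x | ENNReal.ofReal t < h x ^ p} :=
    fun a b hab => measure_mono fun x hx => (ENNReal.ofReal_le_ofReal hab).trans_lt hx
  rw [← lintegral_const_mul _ hanti.measurable]
  refine lintegral_mono fun t => ?_
  have hset : ∀ w : Y → ℝ≥0∞, {x | ENNReal.ofReal t < w x ^ p} =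
      {x | ENNReal.ofReal t ^ p⁻¹ < w x} := fun w => by
    ext x
    exact (ENNReal.rpow_inv_lt_iff hp).symm
  rw [hset, hset, Measure.restrict_apply (measurableSet_lt measurable_const hh), inter_comm]
  exact hfh _

end Whitney

section WhitneyExtension

open Metric

theorem abs_weighted_avg_sub_le {ι : Type*} (A : Finset ι) {w U : ι → ℝ} (hw : ∀ i ∈ A, 0 ≤ w i)
    (hpos : 0 < ∑ i ∈ A, w i) {c M : ℝ} (h : ∀ i ∈ A, |U i - c| ≤ M) :
    |(∑ i ∈ A, w i * U i) / ∑ i ∈ A, w i - c| ≤ M := by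
  have : (∑ i ∈ A, w i * U i) / ∑ i ∈ A, w i - c = (∑ i ∈ A, w i * (U i - c)) / ∑ i ∈ A, w i := by
    rw [eq_div_iff hpos.ne', sub_mul, div_mul_cancel₀ _ hpos.ne', Finset.mul_sum,
      ← Finset.sum_sub_distrib]
    exact Finset.sum_congr rfl fun i _ => by ring
  rw [this, abs_div, abs_of_pos hpos, div_le_iff₀ hpos, Finset.mul_sum]
  refine (Finset.abs_sum_le_sum_abs _ _).trans (Finset.sum_le_sum fun i hi => ?_)
  rw [abs_mul, abs_of_nonneg (hw i hi), mul_comm]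
  exact mul_le_mul_of_nonneg_right (h i hi) (hw i hi)

theorem abs_weighted_avg_sub_avg_le {ι : Type*} (T : Finset ι) {w w' U : ι → ℝ}
    (hw : 1 / 2 ≤ ∑ i ∈ T, w i) (hw' : 0 < ∑ i ∈ T, w' i) {κ M : ℝ}
    (hκ : ∀ i ∈ T, |w i - w' i| ≤ κ)
    (hM : ∀ i ∈ T, |U i - (∑ i ∈ T, w' i * U i) / ∑ i ∈ T, w' i| ≤ M) :
    |(∑ i ∈ T, w i * U i) / ∑ i ∈ T, w i - (∑ i ∈ T, w' i * U i) / ∑ i ∈ T, w' i| ≤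
      2 * (T.card * (κ * M)) := by
  set c := (∑ i ∈ T, w' i * U i) / ∑ i ∈ T, w' i with hc
  have h0 : ∑ i ∈ T, w' i * (U i - c) = 0 := by
    simp only [mul_sub, Finset.sum_sub_distrib, ← Finset.sum_mul]
    rw [hc, mul_div_cancel₀ _ hw'.ne', sub_self]
  have hpos : 0 < ∑ i ∈ T, w i := by linarith
  have h1 : (∑ i ∈ T, w i * U i) / ∑ i ∈ T, w i - c =
      (∑ i ∈ T, (w i - w' i) * (U i - c)) / ∑ i ∈ T, w i := by
    rw [eq_div_iff hpos.ne', sub_mul, div_mul_cancel₀ _ hpos.ne']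
    simp only [sub_mul (w _), Finset.sum_sub_distrib, h0, sub_zero]
    simp only [mul_sub, Finset.sum_sub_distrib, ← Finset.sum_mul]
    ring
  have h2 : |∑ i ∈ T, (w i - w' i) * (U i - c)| ≤ T.card * (κ * M) := by
    refine (Finset.abs_sum_le_sum_abs _ _).trans ?_
    rw [← nsmul_eq_mul]
    refine Finset.sum_le_card_nsmul _ _ _ fun i hi => ?_
    rw [abs_mul]
    exact mul_le_mul (hκ i hi) (hM i hi) (abs_nonneg _) ((abs_nonneg _).trans (hκ i hi))
  rw [h1, abs_div, abs_of_pos hpos, div_le_iff₀ hpos]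
  nlinarith [(abs_nonneg _).trans h2]

variable {Y : Type*} [MetricSpace Y]

/-- The unnormalized Whitney bump function centered at `z`. -/
def whitneyBump (F : Set Y) (z x : Y) : ℝ := max 0 (2 - 8 * dist x z / infDist z F)

theorem whitneyBump_nonneg (F : Set Y) (z x : Y) : 0 ≤ whitneyBump F z x := le_max_left _ _

theorem whitneyBump_eq_zero {F : Set Y} {z x : Y} (hz : 0 < infDist z F)
    (h : infDist z F / 4 ≤ dist x z) : whitneyBump F z x = 0 := by
  refine max_eq_left ?_
  rw [sub_nonpos, le_div_iff₀ hz]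
  linarith

theorem half_le_whitneyBump {F : Set Y} {z x : Y} (hz : 0 < infDist z F)
    (h : dist x z < infDist z F / 10) : 1 / 2 ≤ whitneyBump F z x := by
  refine le_max_of_le_right ?_
  have : 8 * dist x z / infDist z F ≤ 3 / 2 := by
    rw [div_le_iff₀ hz]
    linarith
  linarith

theorem abs_whitneyBump_sub_le {F : Set Y} {z : Y} (hz : 0 < infDist z F) (x y : Y) :
    |whitneyBump F z x - whitneyBump F z y| ≤ 8 * dist x y / infDist z F := by
  unfold whitneyBump
  rw [max_comm 0, max_comm 0]
  refine (abs_max_sub_max_le_abs (2 - 8 * dist x z / infDist z F)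
    (2 - 8 * dist y z / infDist z F) 0).trans ?_
  have : 2 - 8 * dist x z / infDist z F - (2 - 8 * dist y z / infDist z F) =
      8 * (dist y z - dist x z) / infDist z F := by ring
  rw [this, abs_div, abs_of_pos hz, abs_mul, abs_of_pos (by norm_num : (0 : ℝ) < 8)]
  gcongr
  rw [dist_comm x y]
  exact abs_dist_sub_le y x z

open Classical in
/-- The Whitney-type average of the values `u (a z)`, equal to `u` on `F`. -/
def whitneyAvg (F : Set Y) (act : Y → Finset Y) (a : Y → Y) (u : Y → ℝ) (x : Y) : ℝ :=
  if x ∈ F then u x else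
    (∑ z ∈ act x, whitneyBump F z x * u (a z)) / ∑ z ∈ act x, whitneyBump F z x

/-- The Whitney-type extension: the average, cut off at distance `1` from `F`. -/
def whitneyExt (F : Set Y) (act : Y → Finset Y) (a : Y → Y) (u : Y → ℝ) (x : Y) : ℝ :=
  max 0 (1 - infDist x F) * whitneyAvg F act a u x

open Classical in
/-- The extension of a nonnegative function by its maximum over active centers. -/
def whitneySup (F : Set Y) (act : Y → Finset Y) (a : Y → Y) (g : Y → ℝ≥0∞) (x : Y) : ℝ≥0∞ :=
  if x ∈ F then g x else ⨆ z ∈ act x, g (a z)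

open Classical in
/-- The points of `F` whose values determine the Whitney average at `x`. -/
def whitneyRep (F : Set Y) (act : Y → Finset Y) (a : Y → Y) (x : Y) : Set Y :=
  if x ∈ F then {x} else a '' act x

/-- `Z` is a family of Whitney centers, `act` selects the active ones and `a` associates
reflected points in `F \ E` to them. -/
structure IsWhitney (F E Z : Set Y) (act : Y → Finset Y) (a : Y → Y) (N : ℕ) : Prop where
  isClosed : IsClosed F
  nonempty : F.Nonempty
  countable : Z.Countable
  infDist_mem : ∀ z ∈ Z, 0 < infDist z F ∧ infDist z F < 2
  exists_near : ∀ x, 0 < infDist x F → infDist x F < 2 → ∃ z ∈ Z, dist x z < infDist z F / 10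
  card_act : ∀ x, (act x).card ≤ N
  mem_act : ∀ x z, z ∈ act x ↔ z ∈ Z ∧ dist x z < infDist z F / 4
  mem_point : ∀ z ∈ Z, a z ∈ F \ E
  dist_point : ∀ z ∈ Z, dist (a z) z ≤ 5 / 2 * infDist z F

namespace IsWhitney

variable {F E Z : Set Y} {act : Y → Finset Y} {a : Y → Y} {N : ℕ}

theorem infDist_pos (h : IsWhitney F E Z act a N) {x : Y} (hx : x ∉ F) : 0 < infDist x F :=
  (h.isClosed.notMem_iff_infDist_pos h.nonempty).1 hx

theorem mem_rep (h : IsWhitney F E Z act a N) {x : Y} (hx : x ∉ E) {y : Y}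
    (hy : y ∈ whitneyRep F act a x) : y ∈ F \ E ∧ dist y x ≤ 4 * infDist x F := by
  unfold whitneyRep at hy
  split_ifs at hy with hxF
  · rw [mem_singleton_iff.1 hy, dist_self]
    exact ⟨⟨hxF, hx⟩, by have := infDist_nonneg (x := x) (s := F); positivity⟩
  · obtain ⟨z, hz, rfl⟩ := hy
    have hz' := (h.mem_act x z).1 hz
    refine ⟨h.mem_point z hz'.1, ?_⟩
    have h1 := h.dist_point z hz'.1
    have h2 := (infDist_comparable hz'.2).2
    have h3 := dist_triangle (a z) z x
    rw [dist_comm z x] at h3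
    have h4 := infDist_nonneg (x := x) (s := F)
    linarith [hz'.2]

omit [MetricSpace Y] in
theorem le_whitneySup {x y : Y} (hy : y ∈ whitneyRep F act a x) (g : Y → ℝ≥0∞) :
    g y ≤ whitneySup F act a g x := by
  unfold whitneyRep at hy
  unfold whitneySup
  split_ifs at hy ⊢ with hxF
  · rw [mem_singleton_iff.1 hy]
  · obtain ⟨z, hz, rfl⟩ := hy
    exact le_iSup₂ (f := fun z (_ : z ∈ act x) => g (a z)) z hz

theorem half_le_sum (h : IsWhitney F E Z act a N) {x : Y} (hx : x ∉ F) (hx2 : infDist x F < 2) :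
    1 / 2 ≤ ∑ z ∈ act x, whitneyBump F z x := by
  obtain ⟨z, hz, hxz⟩ := h.exists_near x (h.infDist_pos hx) hx2
  have hz0 := (h.infDist_mem z hz).1
  refine (half_le_whitneyBump hz0 hxz).trans ?_
  exact Finset.single_le_sum (f := fun z => whitneyBump F z x)
    (fun z _ => whitneyBump_nonneg F z x) ((h.mem_act x z).2 ⟨hz, by linarith⟩)

theorem abs_avg_sub_le (h : IsWhitney F E Z act a N) {u : Y → ℝ} {x : Y} (hx2 : infDist x F < 2)
    {c M : ℝ} (hM : ∀ y ∈ whitneyRep F act a x, |u y - c| ≤ M) :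
    |whitneyAvg F act a u x - c| ≤ M := by
  unfold whitneyRep at hM
  unfold whitneyAvg
  split_ifs at hM ⊢ with hxF
  · exact hM x rfl
  · exact abs_weighted_avg_sub_le _ (fun z _ => whitneyBump_nonneg F z x)
      (by linarith [h.half_le_sum hxF hx2]) fun z hz => hM _ ⟨z, hz, rfl⟩

/-- Comparison of the averages at two nearby points far from `F`. -/
theorem abs_avg_sub_avg_le (h : IsWhitney F E Z act a N) {u : Y → ℝ} {x y : Y} {t M : ℝ}
    (hxy : dist x y ≤ t) (ht : 0 < t) (hx : 8 * t ≤ infDist x F) (hx2 : infDist x F < 2)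
    (hy2 : infDist y F < 2)
    (hM : ∀ c ∈ whitneyRep F act a x ∪ whitneyRep F act a y, ∀ c' ∈ whitneyRep F act a y,
      |u c - u c'| ≤ M * (infDist x F / t)) :
    |whitneyAvg F act a u x - whitneyAvg F act a u y| ≤ 48 * N * M := by
  classical
  set r := infDist x F with hr
  have hr0 : 0 < r := by linarith
  have hyr : 7 / 8 * r ≤ infDist y F := by
    have h1 := infDist_le_infDist_add_dist (s := F) (x := x) (y := y)
    linarith
  have hxF : x ∉ F := (h.isClosed.notMem_iff_infDist_pos h.nonempty).2 hr0
  have hyF : y ∉ F := (h.isClosed.notMem_iff_infDist_pos h.nonempty).2 (by linarith)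
  have hbound : ∀ c ∈ whitneyRep F act a x ∪ whitneyRep F act a y,
      |u c - whitneyAvg F act a u y| ≤ M * (r / t) := fun c hc => by
    rw [abs_sub_comm]
    exact h.abs_avg_sub_le hy2 fun c' hc' => by rw [abs_sub_comm]; exact hM c hc c' hc'
  have hsum : ∀ w ∈ ({x, y} : Set Y), ∀ φ : Y → ℝ, ∑ z ∈ act w, whitneyBump F z w * φ z =
      ∑ z ∈ act x ∪ act y, whitneyBump F z w * φ z := by
    intro w hw φ
    refine Finset.sum_subset ?_ fun z hz hzw => ?_
    · rcases hw with rfl | rfl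
      · exact Finset.subset_union_left
      · exact Finset.subset_union_right
    · have hzZ : z ∈ Z := by
        rcases Finset.mem_union.1 hz with h1 | h1
        · exact ((h.mem_act _ _).1 h1).1
        · exact ((h.mem_act _ _).1 h1).1
      have : infDist z F / 4 ≤ dist w z := by
        by_contra hcon
        exact hzw ((h.mem_act _ _).2 ⟨hzZ, not_le.1 hcon⟩)
      rw [whitneyBump_eq_zero (h.infDist_mem z hzZ).1 this, zero_mul]
  have hsum1 : ∀ w ∈ ({x, y} : Set Y), ∑ z ∈ act w, whitneyBump F z w =
      ∑ z ∈ act x ∪ act y, whitneyBump F z w := fun w hw => by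
    simpa using hsum w hw fun _ => 1
  have hax : whitneyAvg F act a u x = (∑ z ∈ act x ∪ act y, whitneyBump F z x * u (a z)) /
      ∑ z ∈ act x ∪ act y, whitneyBump F z x := by
    rw [← hsum1 x (by simp), ← hsum x (by simp) fun z => u (a z), whitneyAvg, if_neg hxF]
  have hay : whitneyAvg F act a u y = (∑ z ∈ act x ∪ act y, whitneyBump F z y * u (a z)) /
      ∑ z ∈ act x ∪ act y, whitneyBump F z y := by
    rw [← hsum1 y (by simp), ← hsum y (by simp) fun z => u (a z), whitneyAvg, if_neg hyF]
  have hmain := abs_weighted_avg_sub_avg_le (act x ∪ act y) (w := fun z => whitneyBump F z x)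
    (w' := fun z => whitneyBump F z y) (U := fun z => u (a z)) (κ := 12 * (t / r))
    (M := M * (r / t)) ?_ ?_ ?_ ?_
  · rw [hax, hay]
    refine hmain.trans ?_
    have h1 : 12 * (t / r) * (M * (r / t)) = 12 * M := by field_simp
    rw [h1]
    have hM0 : 0 ≤ M := by
      obtain ⟨z, hz, hz'⟩ := h.exists_near x hr0 hx2
      have hz'' : z ∈ act x := (h.mem_act x z).2
        ⟨hz, by linarith [(h.infDist_mem z hz).1]⟩
      have h2 := (abs_nonneg _).trans (hbound (a z) (Or.inl (by
        rw [whitneyRep, if_neg hxF]; exact ⟨z, hz'', rfl⟩)))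
      exact nonneg_of_mul_nonneg_left h2 (by positivity)
    have hcard : ((act x ∪ act y).card : ℝ) ≤ 2 * N := by
      have := (Finset.card_union_le (act x) (act y)).trans
        (add_le_add (h.card_act x) (h.card_act y))
      calc ((act x ∪ act y).card : ℝ) ≤ ((N + N : ℕ) : ℝ) := by exact_mod_cast this
        _ = 2 * N := by push_cast; ring
    nlinarith
  · rw [← hsum1 x (by simp)]
    exact h.half_le_sum hxF hx2
  · rw [← hsum1 y (by simp)]
    linarith [h.half_le_sum hyF hy2]
  · intro z hz
    have hzZ : 0 < infDist z F ∧ 7 / 10 * r ≤ infDist z F := by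
      rcases Finset.mem_union.1 hz with h1 | h1
      · have h2 := (h.mem_act _ _).1 h1
        exact ⟨(h.infDist_mem z h2.1).1, by linarith [(infDist_comparable h2.2).1]⟩
      · have h2 := (h.mem_act _ _).1 h1
        exact ⟨(h.infDist_mem z h2.1).1, by linarith [(infDist_comparable h2.2).1]⟩
    refine (abs_whitneyBump_sub_le hzZ.1 x y).trans ?_
    rw [div_le_iff₀ hzZ.1]
    have : 12 * (t / r) * (7 / 10 * r) ≤ 12 * (t / r) * infDist z F := by
      gcongr
      exact hzZ.2
    have h3 : 12 * (t / r) * (7 / 10 * r) = 8.4 * t := by field_simp; norm_num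
    linarith
  · intro z hz
    rw [← hay]
    refine hbound _ ?_
    rw [whitneyRep, whitneyRep, if_neg hxF, if_neg hyF]
    rcases Finset.mem_union.1 hz with h1 | h1
    · exact Or.inl ⟨z, h1, rfl⟩
    · exact Or.inr ⟨z, h1, rfl⟩

end IsWhitney

end WhitneyExtension

section WhitneyEstimate

open Metric

variable {Y : Type*} [MetricSpace Y] {F E Z : Set Y} {act : Y → Finset Y} {a : Y → Y} {N : ℕ}

theorem MultiscaleBound.abs_rep_sub_le {b β L : ℝ} (hb : 0 < b) (hL : 1 ≤ L)
    {u : Y → ℝ} {g : ℤ → Y → ℝ≥0∞} (hmb : MultiscaleBound b β L (F \ E) u g)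
    (h : IsWhitney F E Z act a N) {x y : Y} (hx : x ∉ E) (hy : y ∉ E) {c c' : Y}
    (hc : c ∈ whitneyRep F act a x ∪ whitneyRep F act a y)
    (hc' : c' ∈ whitneyRep F act a x ∪ whitneyRep F act a y) {t m H : ℝ} (hm : 1 ≤ m)
    (ht : 0 ≤ t) (hd : dist c c' ≤ m * t) (hH0 : 0 ≤ H)
    (hH : modu b β (fun k => whitneySup F act a (g k) x) t +
      modu b β (fun k => whitneySup F act a (g k) y) t ≤ ENNReal.ofReal H) :
    |u c - u c'| ≤ 2 * L * m * H := by
  have key : ∀ d ∈ whitneyRep F act a x ∪ whitneyRep F act a y, d ∈ F \ E ∧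
      modu b β (fun k => g k d) (m * t) ≤ ENNReal.ofReal (m * H) := by
    intro d hd
    have h1 : modu b β (fun k => g k d) t ≤ ENNReal.ofReal H := by
      rcases hd with hd | hd
      · exact (modu_mono hb (fun k => IsWhitney.le_whitneySup hd (g k)) le_rfl).trans
          (le_self_add.trans hH)
      · exact (modu_mono hb (fun k => IsWhitney.le_whitneySup hd (g k)) le_rfl).trans
          (le_add_self.trans hH)
    refine ⟨hd.elim (fun hd => (h.mem_rep hx hd).1) fun hd => (h.mem_rep hy hd).1, ?_⟩
    refine (modu_mul_le hb _ hm ht).trans ?_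
    rw [ENNReal.ofReal_mul (by linarith)]
    gcongr
  have h2 := hmb.edist_le hb hL (key c hc).1 (key c' hc').1 hd
  have h3 : edist (u c) (u c') ≤ ENNReal.ofReal (2 * L * m * H) := by
    refine h2.trans ?_
    calc _ ≤ ENNReal.ofReal L * (ENNReal.ofReal (m * H) + ENNReal.ofReal (m * H)) := by
          gcongr
          · exact (key c hc).2
          · exact (key c' hc').2
      _ = _ := by
          rw [← ENNReal.ofReal_add (by positivity) (by positivity),
            ← ENNReal.ofReal_mul (by linarith)]
          congr 1
          ring
  rw [edist_dist, ENNReal.ofReal_le_ofReal_iff (by positivity), Real.dist_eq] at h3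
  exact h3

theorem IsWhitney.ofReal_abs_avg_le (h : IsWhitney F E Z act a N) {u : Y → ℝ} {g : Y → ℝ≥0∞}
    (hu0 : ∀ x ∈ F \ E, ENNReal.ofReal |u x| ≤ g x) {x : Y} (hx : x ∉ E)
    (hx2 : infDist x F < 2) :
    ENNReal.ofReal |whitneyAvg F act a u x| ≤ whitneySup F act a g x := by
  by_cases htop : whitneySup F act a g x = ∞
  · simp [htop]
  rw [ENNReal.ofReal_le_iff_le_toReal htop]
  have := h.abs_avg_sub_le (u := u) hx2 (c := 0) (M := (whitneySup F act a g x).toReal) ?_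
  · simpa using this
  · intro y hy
    rw [sub_zero, ← ENNReal.ofReal_le_iff_le_toReal htop]
    exact (hu0 y (h.mem_rep hx hy).1).trans (le_whitneySup hy g)

theorem IsWhitney.ofReal_abs_ext_le (h : IsWhitney F E Z act a N) {u : Y → ℝ} {g : Y → ℝ≥0∞}
    (hu0 : ∀ x ∈ F \ E, ENNReal.ofReal |u x| ≤ g x) {x : Y} (hx : x ∉ E) :
    ENNReal.ofReal |whitneyExt F act a u x| ≤ whitneySup F act a g x := by
  unfold whitneyExt
  rcases le_or_gt 1 (infDist x F) with h1 | h1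
  · rw [max_eq_left (by linarith)]
    simp
  · refine le_trans (ENNReal.ofReal_le_ofReal ?_) (h.ofReal_abs_avg_le hu0 hx (by linarith))
    rw [abs_mul, abs_of_nonneg (le_max_left _ _)]
    refine mul_le_of_le_one_left (abs_nonneg _) (max_le zero_le_one ?_)
    linarith [infDist_nonneg (x := x) (s := F)]

/-- The Whitney extension inherits the multiscale smoothness of the function. -/
theorem IsWhitney.edist_ext_le (h : IsWhitney F E Z act a N) {b β L : ℝ} (hb : 0 < b)
    (hL : 1 ≤ L) {u : Y → ℝ} {g : ℤ → Y → ℝ≥0∞} (hmb : MultiscaleBound b β L (F \ E) u g)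
    (hu0 : ∀ x ∈ F \ E, ENNReal.ofReal |u x| ≤ g 0 x) {x y : Y} (hx : x ∉ E) (hy : y ∉ E)
    {t : ℝ} (ht : 0 < t) (hxy : dist x y ≤ t) :
    edist (whitneyExt F act a u x) (whitneyExt F act a u y) ≤
      ENNReal.ofReal (1 + (148 + 960 * N) * L) *
        (modu b β (fun k => whitneySup F act a (g k) x) t +
          modu b β (fun k => whitneySup F act a (g k) y) t) := by
  set ωx := modu b β (fun k => whitneySup F act a (g k) x) t with hωx
  set ωy := modu b β (fun k => whitneySup F act a (g k) y) t with hωy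
  have hC1 : 1 ≤ 1 + (148 + 960 * (N : ℝ)) * L := by
    have : 0 ≤ (148 + 960 * (N : ℝ)) * L := by positivity
    linarith
  have hC1' : 1 ≤ ENNReal.ofReal (1 + (148 + 960 * (N : ℝ)) * L) := by
    rwa [ENNReal.one_le_ofReal]
  by_cases htop : ωx + ωy = ∞
  · rw [htop, ENNReal.mul_top (by positivity)]
    exact le_top
  rcases lt_or_ge 1 t with ht1 | ht1
  · have h1 : ∀ w ∉ E, ENNReal.ofReal |whitneyExt F act a u w| ≤
        modu b β (fun k => whitneySup F act a (g k) w) t := fun w hw => by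
      refine (h.ofReal_abs_ext_le hu0 hw).trans (le_trans ?_
        (modu_mono hb (fun k => le_rfl) ht1.le))
      simpa using ofReal_mul_le_modu (b := b) (β := β)
        (fun k => whitneySup F act a (g k) w) (t := 1) le_rfl
    calc edist (whitneyExt F act a u x) (whitneyExt F act a u y)
        ≤ edist (whitneyExt F act a u x) 0 + edist 0 (whitneyExt F act a u y) :=
          edist_triangle _ _ _
      _ = ENNReal.ofReal |whitneyExt F act a u x| + ENNReal.ofReal |whitneyExt F act a u y| := by
          rw [edist_dist, edist_dist, Real.dist_eq, Real.dist_eq, sub_zero, zero_sub, abs_neg]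
      _ ≤ ωx + ωy := add_le_add (h1 x hx) (h1 y hy)
      _ ≤ _ := le_mul_of_one_le_left' hC1'
  set H := (ωx + ωy).toReal with hH
  have hHω : ωx + ωy = ENNReal.ofReal H := (ENNReal.ofReal_toReal htop).symm
  have hH0 : 0 ≤ H := ENNReal.toReal_nonneg
  rw [hHω, ← ENNReal.ofReal_mul (by linarith), edist_dist, Real.dist_eq]
  refine ENNReal.ofReal_le_ofReal ?_
  have hd1 : |infDist x F - infDist y F| ≤ t := by
    rw [abs_le]
    have h1 := infDist_le_infDist_add_dist (s := F) (x := x) (y := y)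
    have h2 := infDist_le_infDist_add_dist (s := F) (x := y) (y := x)
    rw [dist_comm y x] at h2
    constructor <;> linarith
  have hd2 := abs_le.1 hd1
  have hrep : ∀ c ∈ whitneyRep F act a x ∪ whitneyRep F act a y,
      ∀ c' ∈ whitneyRep F act a x ∪ whitneyRep F act a y, ∀ m : ℝ, 1 ≤ m → dist c c' ≤ m * t →
      |u c - u c'| ≤ 2 * L * m * H := fun c hc c' hc' m hm hd =>
    hmb.abs_rep_sub_le hb hL h hx hy hc hc' hm ht.le hd hH0 hHω.le
  have hbd : 0 ≤ (148 + 960 * (N : ℝ)) * L * H := by positivity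
  by_cases hfar : 1 ≤ infDist x F ∧ 1 ≤ infDist y F
  · unfold whitneyExt
    rw [max_eq_left (by linarith [hfar.1]), max_eq_left (by linarith [hfar.2])]
    simp only [zero_mul, sub_zero, abs_zero]
    positivity
  have hx2 : infDist x F < 2 := by
    by_contra hcon
    exact hfar ⟨by linarith, by linarith⟩
  have hy2 : infDist y F < 2 := by
    by_contra hcon
    exact hfar ⟨by linarith, by linarith⟩
  have hdist : ∀ c ∈ whitneyRep F act a x ∪ whitneyRep F act a y,
      ∀ c' ∈ whitneyRep F act a y, dist c c' ≤ 8 * infDist x F + 10 * t := by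
    intro c hc c' hc'
    have h1 := (h.mem_rep hy hc').2
    have h2 : dist c x ≤ 4 * infDist x F + 5 * t := by
      rcases hc with hc | hc
      · linarith [(h.mem_rep hx hc).2]
      · have h3 := (h.mem_rep hy hc).2
        have h4 := dist_triangle c y x
        rw [dist_comm y x] at h4
        linarith
    have h5 : dist x c' ≤ 4 * infDist x F + 5 * t := by
      have h4 := dist_triangle x y c'
      rw [dist_comm y c'] at h4
      linarith
    linarith [dist_triangle c x c']
  have havg : |whitneyAvg F act a u x - whitneyAvg F act a u y| ≤
      (148 + 960 * (N : ℝ)) * L * H := by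
    rcases lt_or_ge (infDist x F) (8 * t) with hnear | hfar'
    · refine (?_ : _ ≤ 148 * L * H).trans (by
        have : 0 ≤ 960 * (N : ℝ) * L * H := by positivity
        linarith)
      rw [abs_sub_comm]
      refine h.abs_avg_sub_le hy2 fun c' hc' => ?_
      rw [abs_sub_comm]
      refine h.abs_avg_sub_le hx2 fun c hc => ?_
      have := hrep c (Or.inl hc) c' (Or.inr hc') 74 (by norm_num)
        (by linarith [hdist c (Or.inl hc) c' hc'])
      linarith
    · refine (h.abs_avg_sub_avg_le (M := 20 * L * H) hxy ht hfar' hx2 hy2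
        fun c hc c' hc' => ?_).trans ?_
      · have hm : 1 ≤ 10 * infDist x F / t := by
          rw [le_div_iff₀ ht]
          linarith
        have := hrep c hc c' (Or.inr hc') (10 * infDist x F / t) hm (by
          rw [div_mul_cancel₀ _ ht.ne']
          linarith [hdist c hc c' hc'])
        refine this.trans (le_of_eq ?_)
        ring
      · have : 0 ≤ 148 * L * H := by positivity
        linarith
  have htavg : t * |whitneyAvg F act a u y| ≤ H := by
    have h1 : ENNReal.ofReal (t * |whitneyAvg F act a u y|) ≤ ENNReal.ofReal H := by
      rw [ENNReal.ofReal_mul ht.le, ← hHω]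
      refine le_trans ?_ le_add_self
      exact (mul_le_mul_right (h.ofReal_abs_avg_le hu0 hy hy2) _).trans
        (ofReal_mul_le_modu _ ht1)
    exact (ENNReal.ofReal_le_ofReal_iff hH0).1 h1
  unfold whitneyExt
  have hη : |max 0 (1 - infDist x F) - max 0 (1 - infDist y F)| ≤ t := by
    rw [max_comm 0, max_comm 0]
    refine (abs_max_sub_max_le_abs (1 - infDist x F) (1 - infDist y F) 0).trans ?_
    rw [show 1 - infDist x F - (1 - infDist y F) = -(infDist x F - infDist y F) by ring, abs_neg]
    exact hd1
  have hη1 : |max 0 (1 - infDist x F)| ≤ 1 := by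
    rw [abs_of_nonneg (le_max_left _ _)]
    exact max_le zero_le_one (by linarith [infDist_nonneg (x := x) (s := F)])
  rw [show max 0 (1 - infDist x F) * whitneyAvg F act a u x -
      max 0 (1 - infDist y F) * whitneyAvg F act a u y =
      max 0 (1 - infDist x F) * (whitneyAvg F act a u x - whitneyAvg F act a u y) +
      (max 0 (1 - infDist x F) - max 0 (1 - infDist y F)) * whitneyAvg F act a u y by ring]
  refine (abs_add_le _ _).trans ?_
  rw [abs_mul, abs_mul]
  have h1 := mul_le_of_le_one_left (abs_nonneg
    (whitneyAvg F act a u x - whitneyAvg F act a u y)) hη1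
  have h2 := mul_le_mul_of_nonneg_right hη (abs_nonneg (whitneyAvg F act a u y))
  linarith

end WhitneyEstimate

section WhitneyMeasurability

open Metric Filter

variable {Y : Type*} [MetricSpace Y] [MeasurableSpace Y] [OpensMeasurableSpace Y]
  {F E Z : Set Y} {act : Y → Finset Y} {a : Y → Y} {N : ℕ}

theorem measurable_whitneyBump (F : Set Y) (z : Y) : Measurable (whitneyBump F z) := by
  have : Continuous (whitneyBump F z) := by
    unfold whitneyBump
    fun_prop
  exact this.measurable

namespace IsWhitney

theorem measurable_sum_act (h : IsWhitney F E Z act a N) (φ : Y → ℝ) :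
    Measurable fun x => ∑ z ∈ act x, whitneyBump F z x * φ z := by
  classical
  have := h.countable.to_subtype
  refine measurable_of_tendsto_metrizable' (atTop : Filter (Finset Z))
    (f := fun (s : Finset Z) x => ∑ z ∈ s, whitneyBump F z x * φ z)
    (fun s => Finset.measurable_fun_sum s fun z _ =>
      (measurable_whitneyBump F z).mul_const _) (tendsto_pi_nhds.2 fun x => ?_)
  have hsum : ∑ z ∈ (act x).subtype (· ∈ Z), whitneyBump F z x * φ z =
      ∑ z ∈ act x, whitneyBump F z x * φ z :=
    Finset.sum_subtype_of_mem (fun z => whitneyBump F z x * φ z)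
      fun z hz => ((h.mem_act x z).1 hz).1
  rw [← hsum]
  have : HasSum (fun z : Z => whitneyBump F z x * φ z)
      (∑ z ∈ (act x).subtype (· ∈ Z), whitneyBump F z x * φ z) := by
    refine hasSum_sum_of_ne_finset_zero fun z hz => ?_
    rw [whitneyBump_eq_zero (h.infDist_mem z z.2).1, zero_mul]
    by_contra hcon
    exact hz (Finset.mem_subtype.2 ((h.mem_act x z).2 ⟨z.2, not_le.1 hcon⟩))
  exact this

theorem measurable_ext (h : IsWhitney F E Z act a N) {u : Y → ℝ} (hu : Measurable u) :
    Measurable (whitneyExt F act a u) := by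
  classical
  have h1 : Measurable fun x => ∑ z ∈ act x, whitneyBump F z x := by
    simpa using h.measurable_sum_act fun _ => 1
  have h2 : Measurable (whitneyAvg F act a u) := by
    unfold whitneyAvg
    exact Measurable.ite h.isClosed.measurableSet hu
      ((h.measurable_sum_act fun z => u (a z)).div h1)
  exact (measurable_const.max (measurable_const.sub measurable_infDist)).mul h2

omit [MeasurableSpace Y] [OpensMeasurableSpace Y] in
theorem iSup_act_eq (h : IsWhitney F E Z act a N) (g : Y → ℝ≥0∞) (x : Y) :
    ⨆ z ∈ act x, g (a z) =
      ⨆ z ∈ Z, (ball z (infDist z F / 4)).indicator (fun _ => g (a z)) x := by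
  refine le_antisymm (iSup₂_le fun z hz => ?_) (iSup₂_le fun z hz => ?_)
  · have hz' := (h.mem_act x z).1 hz
    refine le_iSup₂_of_le z hz'.1 ?_
    rw [indicator_of_mem (mem_ball.2 hz'.2)]
  · by_cases hx : x ∈ ball z (infDist z F / 4)
    swap
    · simp [indicator_of_notMem hx]
    rw [indicator_of_mem hx]
    exact le_iSup₂_of_le z ((h.mem_act x z).2 ⟨hz, mem_ball.1 hx⟩) le_rfl

theorem measurable_sup (h : IsWhitney F E Z act a N) {g : Y → ℝ≥0∞} (hg : Measurable g) :
    Measurable (whitneySup F act a g) := by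
  classical
  unfold whitneySup
  refine Measurable.ite h.isClosed.measurableSet hg ?_
  simp only [h.iSup_act_eq]
  exact Measurable.biSup Z h.countable fun z _ =>
    measurable_const.indicator isOpen_ball.measurableSet

omit [MeasurableSpace Y] [OpensMeasurableSpace Y] in
theorem lqN_sup_le (h : IsWhitney F E Z act a N) {q : ℝ≥0∞} (hq : 0 < q) {g : ℤ → Y → ℝ≥0∞}
    {R : Y → ℝ≥0∞} (hR : ∀ x ∈ F \ E, lqN q (fun k => g k x) ≤ R x) {x : Y} (hx : x ∉ E) :
    lqN q (fun k => whitneySup F act a (g k) x) ≤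
      max 1 ((N : ℝ≥0∞) ^ (1 / q.toReal)) * whitneySup F act a R x := by
  unfold whitneySup
  split_ifs with hxF
  · exact (hR x ⟨hxF, hx⟩).trans (le_mul_of_one_le_left' (le_max_left _ _))
  · refine lqN_finset_sup (act x) (fun z k => g k (a z)) (fun z hz => ?_) hq (h.card_act x)
    exact (hR _ (h.mem_point z ((h.mem_act x z).1 hz).1)).trans
      (le_iSup₂ (f := fun z (_ : z ∈ act x) => R (a z)) z hz)

theorem lintegral_sup_le [SecondCountableTopology Y] {μ : Measure Y} [SFinite μ] {D K : ℝ≥0∞}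
    (hμ : IsMetricDoubling μ D) (h : IsWhitney F E Z act a N) {R : Y → ℝ≥0∞} (hR : Measurable R)
    (hpt : ∀ z ∈ Z, ∃ (c : Y) (r : ℝ), 0 < r ∧ r ≤ 1 ∧
      ball z (infDist z F / 4) ⊆ ball c (2 ^ 3 * r) ∧
      ∀ l < R (a z), μ (ball c r) ≤ K * μ (ball c r ∩ (F ∩ {x | l < R x})))
    {p : ℝ} (hp : 0 < p) :
    ∫⁻ x, whitneySup F act a R x ^ p ∂μ ≤ (1 + D ^ 5 * K) * ∫⁻ x in F, R x ^ p ∂μ := by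
  have hF := h.isClosed.measurableSet
  have hoff : ∫⁻ x, (Fᶜ.indicator (whitneySup F act a R)) x ^ p ∂μ ≤
      D ^ 5 * K * ∫⁻ x in F, R x ^ p ∂μ := by
    refine lintegral_rpow_le_of_measure_lt_le ((h.measurable_sup hR).indicator hF.compl) hR
      (fun l => ?_) hp
    choose! c r hr0 hr1 hsub hl using hpt
    refine le_trans (measure_mono ?_) (hμ.vitali {z ∈ Z | l < R (a z)} c r 1
      (fun z hz => ⟨hr0 z hz.1, hr1 z hz.1⟩) 3 K (F ∩ {x | l < R x})
      fun z hz => hl z hz.1 l hz.2)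
    intro x hx
    rw [mem_ofPred_eq] at hx
    by_cases hxF : x ∈ F
    · rw [indicator_of_notMem (by simpa using hxF)] at hx
      exact absurd hx (by simp)
    · rw [indicator_of_mem (show x ∈ Fᶜ from hxF), whitneySup, if_neg hxF, lt_iSup_iff] at hx
      obtain ⟨z, hz⟩ := hx
      rw [lt_iSup_iff] at hz
      obtain ⟨hz, hlz⟩ := hz
      have hz' := (h.mem_act x z).1 hz
      exact mem_iUnion₂.2 ⟨z, ⟨hz'.1, hlz⟩, hsub z hz'.1 (mem_ball.2 hz'.2)⟩
  rw [← lintegral_add_compl _ hF, add_mul, one_mul]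
  refine add_le_add (le_of_eq (setLIntegral_congr_fun hF fun x hx => ?_)) (le_trans (le_of_eq ?_) hoff)
  · simp [whitneySup, hx]
  · rw [← lintegral_indicator hF.compl]
    congr 1
    funext x
    by_cases hx : x ∈ Fᶜ
    · simp [hx]
    · simp [hx, hp]

end IsWhitney

theorem exists_isWhitney [SecondCountableTopology Y] {μ : Measure Y} {D K : ℝ≥0∞}
    (hμ : IsMetricDoubling μ D) {Ω : Set Y} (hne : Ω.Nonempty)
    (hden : ∀ x ∈ Ω, ∀ r : ℝ, 0 < r → r ≤ 1 → μ (ball x r) ≤ K * μ (ball x r ∩ Ω))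
    (hN : D ^ 7 ≤ N) (hE : μ E = 0) (R : Y → ℝ≥0∞) :
    ∃ Z act a, IsWhitney (closure Ω) E Z act a N ∧
      ∀ z ∈ Z, ∃ (c : Y) (r : ℝ), 0 < r ∧ r ≤ 1 ∧
        ball z (infDist z (closure Ω) / 4) ⊆ ball c (2 ^ 3 * r) ∧
        ∀ l < R (a z), μ (ball c r) ≤
          2 * K * μ (ball c r ∩ (closure Ω ∩ {x | l < R x})) := by
  obtain ⟨Z, hZ, hZ2, hnear, act, hcard, hact⟩ := exists_whitney hμ (closure Ω) hN
  have key : ∀ z ∈ Z, ∃ w ∈ closure Ω \ E, dist w z ≤ 5 / 2 * infDist z (closure Ω) ∧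
      ∃ (c : Y) (r : ℝ), 0 < r ∧ r ≤ 1 ∧
        ball z (infDist z (closure Ω) / 4) ⊆ ball c (2 ^ 3 * r) ∧
        ∀ l < R w, μ (ball c r) ≤
          2 * K * μ (ball c r ∩ (closure Ω ∩ {x | l < R x})) := by
    intro z hz
    obtain ⟨h0, h2⟩ := hZ2 z hz
    obtain ⟨c, hc, hzc⟩ := (infDist_lt_iff hne (x := z)).1
      (show infDist z Ω < 2 * infDist z (closure Ω) by rw [infDist_closure] at *; linarith)
    set d := infDist z (closure Ω)
    have hdc := hden c hc (d / 2) (by linarith) (by linarith)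
    have hmono : μ (ball c (d / 2) ∩ Ω) ≤ μ (ball c (d / 2) ∩ closure Ω) :=
      measure_mono (inter_subset_inter_right _ subset_closure)
    have hS0 : μ (ball c (d / 2) ∩ closure Ω) ≠ 0 := fun hcon => by
      rw [hcon, nonpos_iff_eq_zero] at hmono
      rw [hmono, mul_zero, nonpos_iff_eq_zero] at hdc
      exact (hμ.pos c (d / 2) (by linarith)).ne' hdc
    have hSt : μ (ball c (d / 2) ∩ closure Ω) ≠ ∞ :=
      ((measure_mono inter_subset_left).trans_lt (hμ.lt_top c (d / 2))).ne
    obtain ⟨w, hw, hmed⟩ := exists_le_median hS0 hSt hE R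
    refine ⟨w, ⟨hw.1.2, hw.2⟩, ?_, c, d / 2, by linarith, by linarith, ?_, fun l hl => ?_⟩
    · have h3 := mem_ball.1 hw.1.1
      have h4 := dist_triangle w c z
      rw [dist_comm c z] at h4
      linarith
    · intro x hx
      have h3 := mem_ball.1 hx
      have h4 := dist_triangle x z c
      rw [mem_ball]
      linarith
    · calc μ (ball c (d / 2)) ≤ K * μ (ball c (d / 2) ∩ closure Ω) := hdc.trans (by gcongr)
        _ ≤ K * (2 * μ (ball c (d / 2) ∩ closure Ω ∩ {x | l < R x})) := by
            gcongr
            exact hmed l hl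
        _ = _ := by rw [inter_assoc]; ring
  choose! a ha had hpt using key
  exact ⟨Z, act, a, ⟨isClosed_closure, hne.closure, hZ, hZ2, hnear, hcard, hact, ha, had⟩, hpt⟩

theorem measurable_modu {Y : Type*} [MeasurableSpace Y] {b β : ℝ} {g : ℤ → Y → ℝ≥0∞}
    (hg : ∀ k, Measurable (g k)) (t : ℝ) : Measurable fun x => modu b β (fun k => g k x) t := by
  unfold modu
  exact Measurable.iSup fun j => ((hg j).const_mul _).const_mul _

end WhitneyMeasurability

section MetricExtension

open Metric

theorem lqN_mono_const {q : ℝ≥0∞} (hq : 0 < q) {m : ℝ≥0∞} {a c : ℤ → ℝ≥0∞}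
    (h : ∀ k, a k ≤ m * c k) : lqN q a ≤ m * lqN q c := by
  rw [← lqN_const_mul hq]
  exact lqN_mono h

/-- Extension theorem on doubling metric measure spaces, in terms of multiscale bounds. -/
theorem exists_metric_extension {Y : Type*} [MetricSpace Y] [SecondCountableTopology Y]
    [MeasurableSpace Y] [OpensMeasurableSpace Y] {μ : Measure Y} [SFinite μ] {D K : ℝ≥0∞}
    (hμ : IsMetricDoubling μ D) (hK : K ≠ ∞) {Ω : Set Y} (hΩ : MeasurableSet Ω)
    (hne : Ω.Nonempty)
    (hden : ∀ x ∈ Ω, ∀ r : ℝ, 0 < r → r ≤ 1 → μ (ball x r) ≤ K * μ (ball x r ∩ Ω))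
    {b β L p : ℝ} {q : ℝ≥0∞} (hβ : 1 < β) (hβb : β ≤ b) (hqb : q ≠ ∞ → β < b) (hL : 1 ≤ L)
    (hp : 0 < p) (hq : 0 < q) :
    ∃ C : ℝ≥0∞, C ≠ ∞ ∧ ∀ (u : Y → ℝ) (g : ℤ → Y → ℝ≥0∞) (E : Set Y) (δ : ℝ≥0∞),
      Measurable u → (∀ k, Measurable (g k)) → μ E = 0 → MultiscaleBound b β L (Ω \ E) u g →
      (∀ x ∈ Ω \ E, ENNReal.ofReal |u x| ≤ g 0 x) →
      (∀ x ∈ Ω \ E, lqN q (fun k => g k x) ≠ ∞) →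
      ∫⁻ x in Ω, lqN q (fun k => g k x) ^ p ∂μ ≠ ∞ → δ ≠ 0 → δ ≠ ∞ →
      ∃ (v : Y → ℝ) (G : ℤ → Y → ℝ≥0∞) (E' : Set Y), Measurable v ∧ (∀ k, Measurable (G k)) ∧
        μ E' = 0 ∧ (∀ x ∈ Ω, v x = u x) ∧
        (∀ (k : ℤ), ∀ x ∉ E', ∀ y ∉ E', dist x y ≤ L * b ^ (-k) →
          edist (v x) (v y) ≤ ENNReal.ofReal (β ^ (-k)) * (G k x + G k y)) ∧
        (∀ x ∉ E', ENNReal.ofReal |v x| ≤ G 0 x) ∧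
        ∫⁻ x, lqN q (fun k => G k x) ^ p ∂μ ≤
          C * (∫⁻ x in Ω, lqN q (fun k => g k x) ^ p ∂μ + δ) := by
  have hb : 1 < b := hβ.trans_le hβb
  have hb0 : 0 < b := by linarith
  have hβ0 : 0 < β := by linarith
  obtain ⟨N, hN⟩ : ∃ N : ℕ, D ^ 7 ≤ N :=
    (ENNReal.exists_nat_gt (ENNReal.pow_ne_top hμ.ne_top)).imp fun _ h => h.le
  obtain ⟨C₂, hC₂, hmod⟩ := exists_lqN_modu_le hβ hβb hq hqb
  obtain ⟨C₁, hC₁⟩ : ∃ C₁ : ℝ≥0∞, C₁ =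
    ENNReal.ofReal (1 + (148 + 960 * N) * (2 * L)) * ENNReal.ofReal L := ⟨_, rfl⟩
  have hC₁1 : 1 ≤ C₁ := by
    have h1 : 1 ≤ ENNReal.ofReal (1 + (148 + 960 * (N : ℝ)) * (2 * L)) := by
      rw [ENNReal.one_le_ofReal]
      have : 0 ≤ (148 + 960 * (N : ℝ)) * (2 * L) := by positivity
      linarith
    have h2 : 1 ≤ ENNReal.ofReal L := by rwa [ENNReal.one_le_ofReal]
    rw [hC₁]
    simpa using mul_le_mul' h1 h2
  have hC₁t : C₁ ≠ ∞ := hC₁ ▸ ENNReal.mul_ne_top ENNReal.ofReal_ne_top ENNReal.ofReal_ne_top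
  set C₃ : ℝ≥0∞ := max 1 ((N : ℝ≥0∞) ^ (1 / q.toReal)) with hC₃
  have hC₃t : C₃ ≠ ∞ := (max_lt ENNReal.one_lt_top (ENNReal.rpow_lt_top_of_nonneg
    (by positivity) (ENNReal.natCast_ne_top N))).ne
  have hC₀t : C₁ * (C₂ * C₃) ≠ ∞ := ENNReal.mul_ne_top hC₁t (ENNReal.mul_ne_top hC₂ hC₃t)
  refine ⟨(C₁ * (C₂ * C₃)) ^ p * ((1 + D ^ 5 * (2 * K)) * (1 + 2 ^ p * (D ^ 3 * K + 1))),
    ENNReal.mul_ne_top (ENNReal.rpow_ne_top_of_nonneg hp.le hC₀t) ?_, ?_⟩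
  · have hD := hμ.ne_top
    have h2 : (2 : ℝ≥0∞) ^ p ≠ ∞ := ENNReal.rpow_ne_top_of_nonneg hp.le (by simp)
    finiteness
  intro u g E δ hu hg hE hmb hu0 hW hWint hδ hδt
  obtain ⟨w, g', R, E', hw, hg', hR, hE', hwu, hmb', hw0, hgR, hRint⟩ :=
    exists_closure_extension hμ hK hΩ hden hb hL hp hq hu hg hE hmb hu0 hW hWint hδ hδt
  obtain ⟨Z, act, a, hwh, hpt⟩ := exists_isWhitney (N := N) hμ hne hden hN hE' R
  have hgt : ∀ k, Measurable (whitneySup (closure Ω) act a (g' k)) := fun k =>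
    hwh.measurable_sup (hg' k)
  refine ⟨whitneyExt (closure Ω) act a w, fun k x => C₁ * (ENNReal.ofReal (β ^ k) *
    modu b β (fun j => whitneySup (closure Ω) act a (g' j) x) (b ^ (-k))), E',
    hwh.measurable_ext hw, fun k => ((measurable_modu hgt _).const_mul _).const_mul _, hE',
    fun x hx => ?_, fun k x hx y hy hxy => ?_, fun x hx => ?_, ?_⟩
  · rw [whitneyExt, whitneyAvg, if_pos (subset_closure hx), infDist_zero_of_mem_closure
      (subset_closure hx |> fun h => by rwa [closure_closure]), hwu x hx]
    simp
  · have hbk : 0 < b ^ (-k) := by positivity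
    have h1 := hwh.edist_ext_le hb0 (by linarith : 1 ≤ 2 * L) hmb' hw0 hx hy
      (by positivity : 0 < L * b ^ (-k)) hxy
    have hβk : ENNReal.ofReal (β ^ (-k)) * ENNReal.ofReal (β ^ k) = 1 := by
      rw [← ENNReal.ofReal_mul (by positivity), ← zpow_add₀ hβ0.ne']
      simp
    refine h1.trans ?_
    have h2 : ∀ w, modu b β (fun k => whitneySup (closure Ω) act a (g' k) w) (L * b ^ (-k)) ≤
        ENNReal.ofReal L *
          modu b β (fun k => whitneySup (closure Ω) act a (g' k) w) (b ^ (-k)) := fun w =>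
      modu_mul_le hb0 _ hL hbk.le
    refine (mul_le_mul_right (add_le_add (h2 x) (h2 y)) _).trans (le_of_eq ?_)
    rw [← mul_add, ← mul_assoc, ← hC₁, ← mul_add, ← mul_add, mul_left_comm _ C₁,
      ← mul_assoc (ENNReal.ofReal (β ^ (-k))), hβk, one_mul]
  · refine (hwh.ofReal_abs_ext_le hw0 hx).trans ?_
    refine le_trans ?_ (le_mul_of_one_le_left' hC₁1)
    simpa using ofReal_mul_le_modu (b := b) (β := β)
      (fun k => whitneySup (closure Ω) act a (g' k) x) (t := 1) le_rfl
  · have hae : ∀ᵐ x ∂μ, x ∉ E' := measure_eq_zero_iff_ae_notMem.1 hE'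
    calc _ ≤ ∫⁻ x, (C₁ * (C₂ * C₃)) ^ p * whitneySup (closure Ω) act a R x ^ p ∂μ := by
          refine lintegral_mono_ae (hae.mono fun x hx => ?_)
          rw [← ENNReal.mul_rpow_of_nonneg _ _ hp.le]
          refine ENNReal.rpow_le_rpow ?_ hp.le
          rw [lqN_const_mul hq, mul_assoc, mul_assoc]
          refine mul_le_mul_right ((hmod _).trans ?_) _
          exact mul_le_mul_right (hwh.lqN_sup_le hq hgR hx) _
      _ = (C₁ * (C₂ * C₃)) ^ p * ∫⁻ x, whitneySup (closure Ω) act a R x ^ p ∂μ :=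
          lintegral_const_mul' _ _ (ENNReal.rpow_ne_top_of_nonneg hp.le hC₀t)
      _ ≤ (C₁ * (C₂ * C₃)) ^ p * ((1 + D ^ 5 * (2 * K)) * ((1 + 2 ^ p * (D ^ 3 * K + 1)) *
            (∫⁻ x in Ω, lqN q (fun k => g k x) ^ p ∂μ + δ))) := by
          gcongr
          exact (hwh.lintegral_sup_le hμ hR hpt hp).trans (by gcongr)
      _ = _ := by simp only [mul_assoc]

end MetricExtension

section Transfer

variable {Y : Type*}

theorem zpow_rpow_comm (a : ℝ) (k : ℤ) : ((2 : ℝ) ^ k) ^ a = ((2 : ℝ) ^ a) ^ k := by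
  rw [← Real.rpow_intCast, ← Real.rpow_intCast, ← Real.rpow_mul (by norm_num),
    ← Real.rpow_mul (by norm_num), mul_comm]

theorem exists_dyadic_scale {t : ℝ} (ht : 0 < t) :
    ∃ k : ℤ, (2 : ℝ) ^ (-k - 1) ≤ t ∧ t < (2 : ℝ) ^ (-k) := by
  obtain ⟨n, h1, h2⟩ := exists_mem_Ico_zpow ht (by norm_num : (1 : ℝ) < 2)
  refine ⟨-n - 1, ?_, ?_⟩
  · rwa [show -(-n - 1) - 1 = n by ring]
  · rwa [show -(-n - 1) = n + 1 by ring]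

theorem lqN_single {q : ℝ≥0∞} (hq : 0 < q) (c : ℝ≥0∞) :
    lqN q (fun k => if k = 0 then c else 0) ≤ c := by
  unfold lqN
  split_ifs with h
  · refine iSup_le fun k => ?_
    dsimp only
    split_ifs <;> simp
  · have hq' : 0 < q.toReal := ENNReal.toReal_pos hq.ne' h
    rw [tsum_eq_single 0 fun k hk => by simp [hk, hq']]
    simp only [↓reduceIte]
    rw [← ENNReal.rpow_mul,
      mul_one_div_cancel hq'.ne', ENNReal.rpow_one]

theorem lqN_max_single_le {q : ℝ≥0∞} (hq : 0 < q) (a : ℤ → ℝ≥0∞) (c : ℝ≥0∞) :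
    lqN q (fun k => max (a k) (if k = 0 then c else 0)) ≤
      max 1 (((2 : ℕ) : ℝ≥0∞) ^ (1 / q.toReal)) * (lqN q a + c) := by
  have := lqN_finset_sup (q := q) (Finset.univ : Finset Bool)
    (fun i k => if i then a k else if k = 0 then c else 0) (M := lqN q a + c) ?_ hq
    (N := 2) (by simp)
  · refine (lqN_mono fun k => ?_).trans this
    refine max_le ?_ ?_
    · exact le_iSup₂_of_le true (Finset.mem_univ _) (by simp)
    · exact le_iSup₂_of_le false (Finset.mem_univ _) (by simp)
  · intro i _
    cases i
    · simpa using (lqN_single hq c).trans le_add_self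
    · simp

theorem lpN_le_iff {Y : Type*} [MeasurableSpace Y] {ν : Measure Y} {p : ℝ} (hp : 0 < p)
    {f : Y → ℝ≥0∞} {M : ℝ≥0∞} : lpN ν p f ≤ M ↔ ∫⁻ x, f x ^ p ∂ν ≤ M ^ p := by
  rw [lpN, one_div, ENNReal.rpow_inv_le_iff hp]

theorem lpN_mono_ae {Y : Type*} [MeasurableSpace Y] {ν : Measure Y} {p : ℝ} (hp : 0 < p)
    {f g : Y → ℝ≥0∞} (h : ∀ᵐ x ∂ν, f x ≤ g x) : lpN ν p f ≤ lpN ν p g := by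
  unfold lpN
  refine ENNReal.rpow_le_rpow (lintegral_mono_ae (h.mono fun x hx => ?_)) (by positivity)
  exact ENNReal.rpow_le_rpow hx hp.le

theorem lpN_const_mul {Y : Type*} [MeasurableSpace Y] {ν : Measure Y} {p : ℝ} (hp : 0 < p)
    {c : ℝ≥0∞} (hc : c ≠ ∞) (f : Y → ℝ≥0∞) : lpN ν p (fun x => c * f x) = c * lpN ν p f := by
  unfold lpN
  simp only [ENNReal.mul_rpow_of_nonneg _ _ hp.le]
  rw [lintegral_const_mul' _ _ (ENNReal.rpow_ne_top_of_nonneg hp.le hc),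
    ENNReal.mul_rpow_of_nonneg _ _ (by positivity), ← ENNReal.rpow_mul,
    mul_one_div_cancel hp.ne', ENNReal.rpow_one]

/-- A function of positive finite norm has a measurable representative which satisfies a
multiscale bound with a controlled sequence. -/
theorem exists_multiscale_data [MetricSpace Y] [MeasurableSpace Y] {ρ : Y → Y → ℝ}
    {μ : Measure Y} (hX : IsQMMS ρ μ) {α K s p : ℝ} {q : ℝ≥0∞} (hα : 0 < α) (hs : 0 < s)
    (hK : 1 ≤ K) (h' : ∀ x y : Y, ρ x y ^ α ≤ K * dist x y)
    (h : ∀ x y : Y, dist x y ≤ K * ρ x y ^ α) (hp : 0 < p) (hq : 0 < q) {Ω : Set Y}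
    (hΩ : MeasurableSet Ω) {u : Y → ℝ} (hu : MemMspq ρ μ Ω s p q u)
    (hN : MNorm ρ μ Ω s p q u ≠ 0) :
    ∃ (u' : Y → ℝ) (g : ℤ → Y → ℝ≥0∞) (E : Set Y), Measurable u' ∧ (∀ k, Measurable (g k)) ∧
      μ E = 0 ∧ (∀ᵐ x ∂μ.restrict Ω, u' x = u x) ∧
      MultiscaleBound (2 ^ α) (2 ^ s) (K * 2 ^ α) (Ω \ E) u' g ∧
      (∀ x ∈ Ω \ E, ENNReal.ofReal |u' x| ≤ g 0 x) ∧
      (∀ x ∈ Ω \ E, lqN q (fun k => g k x) ≠ ∞) ∧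
      ∫⁻ x in Ω, lqN q (fun k => g k x) ^ p ∂μ ≤
        (max 1 (((2 : ℕ) : ℝ≥0∞) ^ (1 / q.toReal))) ^ p * (2 ^ p * (2 ^ p + 1)) *
          MNorm ρ μ Ω s p q u ^ p := by
  set N₀ := MNorm ρ μ Ω s p q u with hN₀
  obtain ⟨hum, hulp, hudot⟩ := hu
  have hN₀t : N₀ ≠ ∞ := ENNReal.add_ne_top.2 ⟨hudot, hulp⟩
  have hlt : MdotNorm ρ μ Ω s p q u < MdotNorm ρ μ Ω s p q u + N₀ :=
    ENNReal.lt_add_right hudot hN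
  rw [MdotNorm] at hlt
  obtain ⟨γ, hγ⟩ := iInf_lt_iff.1 hlt
  obtain ⟨⟨hγ0, hγm, E₀, hE₀, hγE⟩, hγlt⟩ := iInf_lt_iff.1 hγ
  have hγle : lpN (μ.restrict Ω) p (fun x => lqN q fun k => ENNReal.ofReal (γ k x)) ≤ 2 * N₀ := by
    refine hγlt.le.trans ?_
    rw [two_mul]
    exact add_le_add_left (le_self_add : MdotNorm ρ μ Ω s p q u ≤ N₀) _
  have hule : lpN (μ.restrict Ω) p (fun x => ENNReal.ofReal |u x|) ≤ N₀ := le_add_self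
  rw [lpN_le_iff hp] at hγle hule
  set u' := hum.mk u with hu'
  set γ' : ℤ → Y → ℝ := fun k => (hγm k).mk (γ k) with hγ'
  have huu : ∀ᵐ x ∂μ.restrict Ω, u x = u' x := hum.ae_eq_mk
  have hγγ : ∀ᵐ x ∂μ.restrict Ω, ∀ k, γ k x = γ' k x := ae_all_iff.2 fun k => (hγm k).ae_eq_mk
  set g : ℤ → Y → ℝ≥0∞ := fun k x =>
    max (ENNReal.ofReal (γ' k x)) (if k = 0 then ENNReal.ofReal |u' x| else 0) with hg
  have hum' : Measurable u' := hum.measurable_mk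
  have hgm : ∀ k, Measurable (g k) := fun k => by
    have h1 : Measurable fun x => ENNReal.ofReal (γ' k x) := (hγm k).measurable_mk.ennreal_ofReal
    have h2 : Measurable fun x => if k = 0 then ENNReal.ofReal |u' x| else 0 := by
      split_ifs
      · exact (measurable_norm.comp hum').ennreal_ofReal
      · exact measurable_const
    exact h1.max h2
  set C := max 1 (((2 : ℕ) : ℝ≥0∞) ^ (1 / q.toReal)) with hC
  have hCt : C ≠ ∞ := (max_lt ENNReal.one_lt_top (ENNReal.rpow_lt_top_of_nonneg
    (by positivity) (ENNReal.natCast_ne_top 2))).ne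
  have h2t : (2 : ℝ≥0∞) ^ p ≠ ∞ := ENNReal.rpow_ne_top_of_nonneg hp.le (by simp)
  have hgI : ∫⁻ x in Ω, lqN q (fun k => g k x) ^ p ∂μ ≤ C ^ p * (2 ^ p * (2 ^ p + 1)) * N₀ ^ p := by
    have hum2 : AEMeasurable (fun x => ENNReal.ofReal |u x| ^ p) (μ.restrict Ω) :=
      ((measurable_norm.comp_aemeasurable hum).ennreal_ofReal).pow_const p
    calc _ ≤ ∫⁻ x in Ω, C ^ p * (2 ^ p * (lqN q (fun k => ENNReal.ofReal (γ k x)) ^ p +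
            ENNReal.ofReal |u x| ^ p)) ∂μ := by
          refine lintegral_mono_ae ?_
          filter_upwards [huu, hγγ] with x hx1 hx2
          refine (ENNReal.rpow_le_rpow (lqN_max_single_le hq _ _) hp.le).trans ?_
          rw [ENNReal.mul_rpow_of_nonneg _ _ hp.le, ← hx1]
          simp only [← hx2]
          gcongr
          exact lpow_add_le hp.le _ _
      _ = C ^ p * (2 ^ p * (∫⁻ x in Ω, lqN q (fun k => ENNReal.ofReal (γ k x)) ^ p ∂μ +
            ∫⁻ x in Ω, ENNReal.ofReal |u x| ^ p ∂μ)) := by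
          rw [lintegral_const_mul' _ _ (ENNReal.rpow_ne_top_of_nonneg hp.le hCt),
            lintegral_const_mul' _ _ h2t, lintegral_add_right' _ hum2]
      _ ≤ C ^ p * (2 ^ p * ((2 * N₀) ^ p + N₀ ^ p)) := by gcongr
      _ = _ := by
          rw [ENNReal.mul_rpow_of_nonneg _ _ hp.le]
          ring
  have hintt : ∫⁻ x in Ω, lqN q (fun k => g k x) ^ p ∂μ ≠ ∞ := by
    refine ne_top_of_le_ne_top ?_ hgI
    have := ENNReal.rpow_ne_top_of_nonneg hp.le hCt
    have := ENNReal.rpow_ne_top_of_nonneg hp.le hN₀t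
    finiteness
  have hfin : ∀ᵐ x ∂μ.restrict Ω, lqN q (fun k => g k x) ≠ ∞ := by
    refine (ae_lt_top ((measurable_lqN q hgm).pow_const p) hintt).mono fun x hx hx' => ?_
    rw [hx', ENNReal.top_rpow_of_pos hp] at hx
    exact lt_irrefl _ hx
  have hgood := (ae_restrict_iff' hΩ).1 (huu.and (hγγ.and hfin))
  refine ⟨u', g, E₀ ∪ {x | ¬ (x ∈ Ω → u x = u' x ∧ (∀ k, γ k x = γ' k x) ∧
    lqN q (fun k => g k x) ≠ ∞)}, hum', hgm, measure_union_null hE₀ (ae_iff.1 hgood),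
    huu.mono fun x hx => hx.symm, ?_, fun x _ => ?_, ?_, hgI⟩
  · intro x hx y hy hxy
    have hx' : u x = u' x ∧ (∀ k, γ k x = γ' k x) ∧ lqN q (fun k => g k x) ≠ ∞ := by
      by_contra hcon
      exact hx.2 (Or.inr fun hh => hcon (hh hx.1))
    have hy' : u y = u' y ∧ (∀ k, γ k y = γ' k y) ∧ lqN q (fun k => g k y) ≠ ∞ := by
      by_contra hcon
      exact hy.2 (Or.inr fun hh => hcon (hh hy.1))
    have hρ0 := hX.quasi.1 x y
    have hρ : 0 < ρ x y := lt_of_le_of_ne hρ0 fun hcon => hxy ((hX.quasi.2.1 x y).1 hcon.symm)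
    obtain ⟨k, hk1, hk2⟩ := exists_dyadic_scale hρ
    have hb : (0 : ℝ) < 2 ^ α := by positivity
    have hkα : ((2 : ℝ) ^ (-k)) ^ α = (2 ^ α) ^ (-k) := zpow_rpow_comm α (-k)
    have hks : ((2 : ℝ) ^ (-k)) ^ s = (2 ^ s) ^ (-k) := zpow_rpow_comm s (-k)
    have hb1 : (1 : ℝ) ≤ 2 ^ α := Real.one_le_rpow (by norm_num) hα.le
    have hlow : ((2 : ℝ) ^ α) ^ (-k) ≤ 2 ^ α * ρ x y ^ α := by
      rw [← hkα, ← Real.mul_rpow (by norm_num) hρ0]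
      refine Real.rpow_le_rpow (by positivity) ?_ hα.le
      rw [zpow_sub₀ (by norm_num : (2 : ℝ) ≠ 0), zpow_one] at hk1
      linarith
    refine ⟨k, ?_, ?_, ?_⟩
    · refine hlow.trans ?_
      have := mul_le_mul_of_nonneg_left (h' x y) hb.le
      linarith
    · refine (h x y).trans ?_
      have h1 : ρ x y ^ α ≤ (2 ^ α) ^ (-k) := hkα ▸ Real.rpow_le_rpow hρ0 hk2.le hα.le
      have h2 : K * ρ x y ^ α ≤ K * (2 ^ α) ^ (-k) := by gcongr
      refine h2.trans ?_
      rw [mul_assoc]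
      have : ((2 : ℝ) ^ α) ^ (-k) ≤ 2 ^ α * (2 ^ α) ^ (-k) :=
        le_mul_of_one_le_left (by positivity) hb1
      gcongr
    · have h1 := hγE k x ⟨hx.1, fun hh => hx.2 (Or.inl hh)⟩ y
        ⟨hy.1, fun hh => hy.2 (Or.inl hh)⟩ hk1 hk2
      rw [hx'.1, hy'.1] at h1
      have h2 : ρ x y ^ s ≤ (2 ^ s) ^ (-k) := hks ▸ Real.rpow_le_rpow hρ0 hk2.le hs.le
      have h3 : |u' x - u' y| ≤ (2 ^ s) ^ (-k) * (γ k x + γ k y) :=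
        h1.trans (mul_le_mul_of_nonneg_right h2 (add_nonneg (hγ0 k x) (hγ0 k y)))
      rw [edist_dist, Real.dist_eq]
      refine (ENNReal.ofReal_le_ofReal h3).trans ?_
      rw [ENNReal.ofReal_mul (by positivity), ENNReal.ofReal_add (hγ0 k x) (hγ0 k y)]
      rw [hx'.2.1 k, hy'.2.1 k]
      gcongr
      · exact le_max_left _ _
      · exact le_max_left _ _
  · exact le_max_of_le_right (by simp)
  · intro x hx
    by_contra hcon
    exact hx.2 (Or.inr fun hh => (hh hx.1).2.2 hcon)

/-- A function with controlled differences at all dyadic scales belongs to `M^s_{p,q}`. -/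
theorem norms_le_of_multiscale [MetricSpace Y] [MeasurableSpace Y] {ρ : Y → Y → ℝ}
    {μ : Measure Y} (hX : IsQMMS ρ μ) {α K L s p : ℝ} {q : ℝ≥0∞} (hα : 0 < α) (hs : 0 < s)
    (hK : 0 < K) (hKL : K ≤ L) (h : ∀ x y : Y, dist x y ≤ K * ρ x y ^ α) (hp : 0 < p)
    (hq : 0 < q) {v : Y → ℝ} {G : ℤ → Y → ℝ≥0∞} {E : Set Y} (hG : ∀ k, Measurable (G k))
    (hE : μ E = 0)
    (hv : ∀ (k : ℤ), ∀ x ∉ E, ∀ y ∉ E, dist x y ≤ L * ((2 : ℝ) ^ α) ^ (-k) →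
      edist (v x) (v y) ≤ ENNReal.ofReal (((2 : ℝ) ^ s) ^ (-k)) * (G k x + G k y))
    (hv0 : ∀ x ∉ E, ENNReal.ofReal |v x| ≤ G 0 x) {M : ℝ≥0∞} (hM : M ≠ ∞)
    (hgI : ∫⁻ x, lqN q (fun k => G k x) ^ p ∂μ ≤ M ^ p) :
    lpOn μ univ p v ≤ M ∧ MdotNorm ρ μ univ s p q v ≤ ENNReal.ofReal (2 ^ s) * M := by
  have hGM : lpN (μ.restrict univ) p (fun x => lqN q fun k => G k x) ≤ M := by
    rwa [lpN_le_iff hp, Measure.restrict_univ]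
  have hEae : ∀ᵐ x ∂μ, x ∉ E := measure_eq_zero_iff_ae_notMem.1 hE
  constructor
  · refine le_trans (lpN_mono_ae hp ?_) hGM
    rw [Measure.restrict_univ]
    exact hEae.mono fun x hx => (hv0 x hx).trans (le_lqN hq (fun k => G k x) 0)
  have hfin : ∀ᵐ x ∂μ, lqN q (fun k => G k x) ≠ ∞ := by
    refine (ae_lt_top ((measurable_lqN q hG).pow_const p) (ne_top_of_le_ne_top
      (ENNReal.rpow_ne_top_of_nonneg hp.le hM) hgI)).mono fun x hx hx' => ?_
    rw [hx', ENNReal.top_rpow_of_pos hp] at hx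
    exact lt_irrefl _ hx
  set γ : ℤ → Y → ℝ := fun k x => 2 ^ s * (G k x).toReal with hγ
  have hmem : γ ∈ fracGrad ρ μ univ s v := by
    refine ⟨fun k x => by positivity, fun k => ((hG k).ennreal_toReal.const_mul _).aemeasurable,
      E ∪ {x | ¬ lqN q (fun k => G k x) ≠ ∞}, measure_union_null hE (ae_iff.1 hfin), ?_⟩
    intro k x hx y hy hk1 hk2
    have hρ0 := hX.quasi.1 x y
    have hfin' : ∀ w ∈ univ \ (E ∪ {x | ¬ lqN q (fun k => G k x) ≠ ∞}), G k w ≠ ∞ :=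
      fun w hw hcon => hw.2 (Or.inr (by
        rw [mem_ofPred_eq, not_not, ← top_le_iff, ← hcon]
        exact le_lqN hq (fun k => G k w) k))
    have hd : dist x y ≤ L * ((2 : ℝ) ^ α) ^ (-k) := by
      refine (h x y).trans ?_
      rw [← zpow_rpow_comm]
      exact mul_le_mul hKL (Real.rpow_le_rpow hρ0 hk2.le hα.le) (by positivity) (by linarith)
    have h1 := hv k x (fun hh => hx.2 (Or.inl hh)) y (fun hh => hy.2 (Or.inl hh)) hd
    rw [← ENNReal.ofReal_toReal (hfin' x hx), ← ENNReal.ofReal_toReal (hfin' y hy),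
      ← ENNReal.ofReal_add ENNReal.toReal_nonneg ENNReal.toReal_nonneg,
      ← ENNReal.ofReal_mul (by positivity), edist_dist,
      ENNReal.ofReal_le_ofReal_iff (by positivity), Real.dist_eq] at h1
    refine h1.trans ?_
    have h2 : ((2 : ℝ) ^ s) ^ (-k) ≤ 2 ^ s * ρ x y ^ s := by
      rw [← zpow_rpow_comm, ← Real.mul_rpow (by norm_num) hρ0]
      refine Real.rpow_le_rpow (by positivity) ?_ hs.le
      rw [zpow_sub₀ (by norm_num : (2 : ℝ) ≠ 0), zpow_one] at hk1
      linarith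
    calc _ ≤ 2 ^ s * ρ x y ^ s * ((G k x).toReal + (G k y).toReal) := by gcongr
      _ = _ := by simp only [hγ]; ring
  refine (iInf₂_le γ hmem).trans ?_
  calc _ ≤ lpN (μ.restrict univ) p
        (fun x => ENNReal.ofReal (2 ^ s) * lqN q fun k => G k x) := by
        refine lpN_mono_ae hp (Filter.Eventually.of_forall fun x => ?_)
        refine lqN_mono_const hq fun k => ?_
        rw [hγ, ENNReal.ofReal_mul (by positivity)]
        gcongr
        exact ENNReal.ofReal_toReal_le
    _ ≤ _ := by
        rw [lpN_const_mul hp ENNReal.ofReal_ne_top]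
        gcongr

end Transfer

/-- Theorem 1.1 (extension part): measure density implies that `M^s_{p,q}(Ω)` functions
extend to `M^s_{p,q}(X)` with norm control, for `s ⪯_q ind(X,ρ)`. -/
theorem measure_density_implies_M_extension
    {X : Type*} [MeasurableSpace X] (ρ : X → X → ℝ) (μ : Measure X)
    (hX : IsQMMS ρ μ) (hreg : BorelRegular μ)
    (Q : ℝ) (hQ : 0 < Q) (hdoub : QDoubling ρ μ Q)
    (s p : ℝ) (q : ℝ≥0∞) (hs : 0 < s) (hp : 0 < p) (hq : 0 < q)
    (hind : SPrecIndex ρ s q)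
    (Ω : Set X) (hΩmeas : MeasurableSet Ω) (hΩne : Ω.Nonempty)
    (hdens : MeasDensity ρ μ Ω) :
    ∃ C : ℝ, 0 < C ∧ ∀ u : X → ℝ, MemMspq ρ μ Ω s p q u →
      ∃ v : X → ℝ, MemMspq ρ μ Set.univ s p q v ∧
        (∀ᵐ x ∂μ.restrict Ω, v x = u x) ∧
        MNorm ρ μ Set.univ s p q v ≤ ENNReal.ofReal C * MNorm ρ μ Ω s p q u := by
  obtain ⟨α, K, hmet, hsα, hsα', hK, hcomp⟩ := exists_metric ρ hX.quasi s hs q hind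
  have h' : ∀ x y, ρ x y ^ α ≤ K * dist x y := fun x y => (hcomp x y).1
  have h : ∀ x y, dist x y ≤ K * ρ x y ^ α := fun x y => (hcomp x y).2
  have hα : 0 < α := hs.trans_le hsα
  have hK0 : 0 < K := by linarith
  have hsf := sigmaFinite_of_isQMMS hX
  have hsc := secondCountable_of_isQMMS hX hα hK0 h
  have hom := opensMeasurable_of_isQMMS hX hα hK0 h' h
  obtain ⟨D, hμ⟩ := exists_metricDoubling hX hdoub hα hK h' h
  obtain ⟨K', hK', hden⟩ := exists_metricDensity hX hdoub hα hK h' h hdens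
  have hb1 : (1 : ℝ) ≤ 2 ^ α := Real.one_le_rpow (by norm_num) hα.le
  have hKL : K ≤ K * 2 ^ α := le_mul_of_one_le_right hK0.le hb1
  obtain ⟨C, hC, hext⟩ := exists_metric_extension (b := 2 ^ α) (β := 2 ^ s) (L := K * 2 ^ α)
    (p := p) (q := q) hμ hK' hΩmeas hΩne hden (Real.one_lt_rpow (by norm_num) hs)
    (Real.rpow_le_rpow_of_exponent_le (by norm_num) hsα)
    (fun hq' => Real.rpow_lt_rpow_of_exponent_lt (by norm_num) (hsα' hq')) (hK.trans hKL) hp hq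
  obtain ⟨C₁, hC₁⟩ : ∃ C₁ : ℝ≥0∞,
    C₁ = (max 1 (((2 : ℕ) : ℝ≥0∞) ^ (1 / q.toReal))) ^ p * (2 ^ p * (2 ^ p + 1)) := ⟨_, rfl⟩
  have hC₁t : C₁ ≠ ∞ := by
    have h1 : max 1 (((2 : ℕ) : ℝ≥0∞) ^ (1 / q.toReal)) ≠ ∞ :=
      (max_lt ENNReal.one_lt_top (ENNReal.rpow_lt_top_of_nonneg (by positivity)
        (ENNReal.natCast_ne_top 2))).ne
    have h2 : (2 : ℝ≥0∞) ^ p ≠ ∞ := ENNReal.rpow_ne_top_of_nonneg hp.le (by simp)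
    have h3 := ENNReal.rpow_ne_top_of_nonneg hp.le h1
    rw [hC₁]
    finiteness
  obtain ⟨C₂, hC₂⟩ : ∃ C₂ : ℝ≥0∞, C₂ = (C * (C₁ + 1)) ^ (1 / p) := ⟨_, rfl⟩
  have hC₂t : C₂ ≠ ∞ := by
    rw [hC₂]
    exact ENNReal.rpow_ne_top_of_nonneg (by positivity) (by finiteness)
  have hC₃t : ENNReal.ofReal (2 ^ s) * C₂ + C₂ ≠ ∞ := by finiteness
  refine ⟨(ENNReal.ofReal (2 ^ s) * C₂ + C₂).toReal + 1, by positivity, fun u hu => ?_⟩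
  set N₀ := MNorm ρ μ Ω s p q u with hN₀
  have hN₀t : N₀ ≠ ∞ := ENNReal.add_ne_top.2 ⟨hu.2.2, hu.2.1⟩
  suffices hsuff : ∃ v : X → ℝ, AEMeasurable v μ ∧ (∀ᵐ x ∂μ.restrict Ω, v x = u x) ∧
      lpOn μ univ p v ≤ C₂ * N₀ ∧
      MdotNorm ρ μ univ s p q v ≤ ENNReal.ofReal (2 ^ s) * (C₂ * N₀) by
    obtain ⟨v, hvm, hvu, hv1, hv2⟩ := hsuff
    refine ⟨v, ⟨by rwa [Measure.restrict_univ], ne_top_of_le_ne_top (by finiteness) hv1,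
      ne_top_of_le_ne_top (by finiteness) hv2⟩, hvu, ?_⟩
    calc MNorm ρ μ univ s p q v ≤ ENNReal.ofReal (2 ^ s) * (C₂ * N₀) + C₂ * N₀ :=
          add_le_add hv2 hv1
      _ = (ENNReal.ofReal (2 ^ s) * C₂ + C₂) * N₀ := by ring
      _ ≤ _ := by
          gcongr
          rw [← ENNReal.ofReal_toReal hC₃t]
          exact ENNReal.ofReal_le_ofReal (by rw [ENNReal.toReal_ofReal (by positivity)]; linarith)
  by_cases hN0 : N₀ = 0
  · have hu0 : lpOn μ Ω p u = 0 := (add_eq_zero.1 hN0).2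
    have hum : AEMeasurable (fun x => ENNReal.ofReal |u x| ^ p) (μ.restrict Ω) :=
      (measurable_norm.comp_aemeasurable hu.1).ennreal_ofReal.pow_const p
    rw [lpOn, lpN, ENNReal.rpow_eq_zero_iff_of_pos (by positivity), lintegral_eq_zero_iff' hum]
      at hu0
    have hzero := norms_le_of_multiscale (q := q) hX hα hs hK0 hKL h hp hq (v := fun _ => 0)
      (G := fun _ _ => 0) (E := ∅) (fun _ => measurable_const) measure_empty
      (by simp) (by simp) (M := 0) (by simp) (by
        have : lqN q (fun _ => 0) = 0 := by
          unfold lqN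
          split_ifs with hq'
          · simp
          · have := ENNReal.toReal_pos hq.ne' hq'
            simp [this]
        simp [this, hp])
    refine ⟨fun _ => 0, aemeasurable_const, hu0.mono fun x hx => ?_, ?_, ?_⟩
    · have : ENNReal.ofReal |u x| = 0 := by
        simpa [ENNReal.rpow_eq_zero_iff_of_pos hp] using hx
      have : |u x| ≤ 0 := ENNReal.ofReal_eq_zero.1 this
      exact (abs_nonpos_iff.1 this).symm
    · exact hzero.1.trans zero_le
    · exact hzero.2.trans (by simp)
  obtain ⟨u', g, E, hu'm, hgm, hE, hu'u, hmb, hu0, hfin, hgI⟩ :=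
    exists_multiscale_data hX hα hs hK h' h hp hq hΩmeas hu hN0
  rw [← hC₁, ← hN₀] at hgI
  have hNp : N₀ ^ p ≠ ∞ := ENNReal.rpow_ne_top_of_nonneg hp.le hN₀t
  have hNp0 : N₀ ^ p ≠ 0 := by
    rw [Ne, ENNReal.rpow_eq_zero_iff_of_pos hp]
    exact hN0
  obtain ⟨v, G, E', hvm, hGm, hE', hvu, hvG, hv0, hGint⟩ := hext u' g E (N₀ ^ p) hu'm hgm hE hmb
    hu0 hfin (ne_top_of_le_ne_top (by finiteness) hgI) hNp0 hNp
  have hM : ∫⁻ x, lqN q (fun k => G k x) ^ p ∂μ ≤ (C₂ * N₀) ^ p := by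
    refine hGint.trans ?_
    rw [ENNReal.mul_rpow_of_nonneg _ _ hp.le, hC₂, ← ENNReal.rpow_mul, one_div_mul_cancel hp.ne',
      ENNReal.rpow_one, mul_assoc, add_mul, one_mul]
    gcongr
  have hnorms := norms_le_of_multiscale hX hα hs hK0 hKL h hp hq hGm hE' hvG hv0
    (by finiteness) hM
  refine ⟨v, hvm.aemeasurable, ?_, hnorms⟩
  filter_upwards [hu'u, ae_restrict_mem hΩmeas] with x hx hxΩ
  rw [hvu x hxΩ, hx]

end HajlaszPaper
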